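/- Let b > 1/2 and let s₁, s₂, s₃, s₄ ≤ 0 with s₁+s₂+s₃+s₄ = −1/2. Then there exists a constant C such that for all (say, Schwartz) functions u₁, u₂, u₃, u₄ : ℝ² → ℂ one has ‖∂_x(u₁u₂u₃u₄)‖_{X^{0,−b}} ≤ C ∏_{j=1}^{4} ‖u_j‖_{X^{s_j,b}}. -/

import Mathlib

open MeasureTheory Set
open scoped ENNReal

noncomputable section

/-- The Fourier transform `f̂(ξ) = ∫ e^{-ixξ} f(x) dx`. -/
def FT (f : ℝ → ℂ) (ξ : ℝ) : ℂ :=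
  ∫ x : ℝ, Complex.exp (-Complex.I * x * ξ) * f x

/-- The Japanese bracket power `⟨ξ⟩^s = (1 + ξ²)^(s/2)`. -/
def jap (s ξ : ℝ) : ℝ := (1 + ξ ^ 2) ^ (s / 2)

/-- The Gevrey norm `‖f‖_{G^{σ,s}} = ‖e^{σ|ξ|} ⟨ξ⟩^s f̂(ξ)‖_{L²_ξ(ℝ)}`, valued in `ℝ≥0∞`.
`f ∈ G^{σ,s}(ℝ)` means `gevreyNorm σ s f < ⊤`. -/
def gevreyNorm (σ s : ℝ) (f : ℝ → ℂ) : ℝ≥0∞ :=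
  eLpNorm (fun ξ : ℝ => ((Real.exp (σ * |ξ|) * jap s ξ : ℝ) : ℂ) * FT f ξ) 2 volume

/-- The space-time Fourier transform `ũ(τ,ξ) = ∫_{ℝ²} e^{i(tτ+xξ)} u(t,x) dt dx`
(for `u` written in curried form, first variable `t`, second `x`). -/
def FT2 (u : ℝ → ℝ → ℂ) (τ ξ : ℝ) : ℂ :=
  ∫ p : ℝ × ℝ, Complex.exp (Complex.I * (p.1 * τ + p.2 * ξ)) * u p.1 p.2

/-- The Gevrey–Bourgain norm
`‖u‖_{X^{σ,s,b}} = ‖e^{σ|D_x|}u‖_{X^{s,b}} = ‖e^{σ|ξ|} ⟨ξ⟩^s ⟨τ-ξ³⟩^b ũ(τ,ξ)‖_{L²_{τ,ξ}}`.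
Taking `σ = 0` gives the Bourgain norm `‖u‖_{X^{s,b}}`. -/
def XNorm (σ s b : ℝ) (u : ℝ → ℝ → ℂ) : ℝ≥0∞ :=
  eLpNorm (fun p : ℝ × ℝ =>
    ((Real.exp (σ * |p.2|) * jap s p.2 * jap b (p.1 - p.2 ^ 3) : ℝ) : ℂ) * FT2 u p.1 p.2)
    2 volume

/-- The restriction norm `‖u‖_{X^{σ,s,b}_δ} = inf {‖v‖_{X^{σ,s,b}} : v = u on ℝ × (0,δ)}`. -/
def XRestNorm (σ s b δ : ℝ) (u : ℝ → ℝ → ℂ) : ℝ≥0∞ :=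
  sInf {r : ℝ≥0∞ | ∃ v : ℝ → ℝ → ℂ, (∀ t ∈ Set.Ioo 0 δ, v t = u t) ∧ XNorm σ s b v = r}

/-- `u : ℝ → ℝ → E` (curried) is a Schwartz function of the pair of variables. -/
def IsSchwartz {E : Type*} [NormedAddCommGroup E] [NormedSpace ℝ E] (u : ℝ → ℝ → E) : Prop :=
  ∃ φ : SchwartzMap (ℝ × ℝ) E, ∀ t x, u t x = φ (t, x)

theorem mul_setLIntegral_comp_le {s : Set ℝ} (hs : MeasurableSet s) {φ φ' : ℝ → ℝ}
    (hφ : ∀ x ∈ s, HasDerivAt φ (φ' x) x) (hinj : InjOn φ s) {c : ℝ → ℝ}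
    (hc : ∀ x ∈ s, c x ≤ |φ' x|) (f : ℝ → ℝ≥0∞) :
    ∫⁻ x in s, ENNReal.ofReal (c x) * f (φ x) ≤ ∫⁻ x, f x := by
  calc ∫⁻ x in s, ENNReal.ofReal (c x) * f (φ x)
      ≤ ∫⁻ x in s, ENNReal.ofReal |φ' x| * f (φ x) := by
        refine setLIntegral_mono' hs fun x hx => ?_
        gcongr
        exact hc x hx
    _ = ∫⁻ x in φ '' s, f x :=
        (lintegral_image_eq_lintegral_abs_deriv_mul hs
          (fun x hx => (hφ x hx).hasDerivWithinAt) hinj f).symm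
    _ ≤ ∫⁻ x, f x := setLIntegral_le_lintegral _ _

theorem hasDerivAt_sub_cubes (T X ξ : ℝ) :
    HasDerivAt (fun ξ : ℝ => T - ξ ^ 3 - (X - ξ) ^ 3) (-3 * (ξ ^ 2 - (X - ξ) ^ 2)) ξ := by
  have h := (((hasDerivAt_id ξ).pow 3).const_sub T).sub (((hasDerivAt_id ξ).const_sub X).pow 3)
  refine h.congr_deriv ?_
  simp
  ring

theorem lintegral_resonance_two (f : ℝ → ℝ≥0∞) (T X : ℝ) :
    ∫⁻ ξ, ENNReal.ofReal |ξ ^ 2 - (X - ξ) ^ 2| * f (T - ξ ^ 3 - (X - ξ) ^ 3) ≤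
      2 * ∫⁻ x, f x := by
  rcases eq_or_ne X 0 with rfl | hX
  · simp
  have key : ∀ s : Set ℝ, MeasurableSet s →
      (∀ x ∈ s, ∀ y ∈ s, (x - X / 2) ^ 2 = (y - X / 2) ^ 2 → x = y) →
      ∫⁻ ξ in s, ENNReal.ofReal |ξ ^ 2 - (X - ξ) ^ 2| * f (T - ξ ^ 3 - (X - ξ) ^ 3) ≤
        ∫⁻ x, f x := by
    intro s hs hinj
    refine mul_setLIntegral_comp_le hs (fun x _ => hasDerivAt_sub_cubes T X x) ?_ ?_ f
    · intro x hx y hy hxy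
      refine hinj x hx y hy ?_
      refine mul_left_cancel₀ hX ?_
      simp only at hxy
      linarith
    · intro x _
      rw [abs_mul]
      norm_num
      linarith [abs_nonneg (x ^ 2 - (X - x) ^ 2)]
  rw [← lintegral_add_compl _ (measurableSet_Iic (a := X / 2)), two_mul]
  refine add_le_add (key _ measurableSet_Iic ?_) (key _ measurableSet_Iic.compl ?_)
  · intro x hx y hy h
    simp only [mem_Iic] at hx hy
    nlinarith [sq_eq_sq_iff_abs_eq_abs (x - X / 2) (y - X / 2) |>.1 h,
      abs_of_nonpos (sub_nonpos.2 hx), abs_of_nonpos (sub_nonpos.2 hy)]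
  · intro x hx y hy h
    simp only [mem_compl_iff, mem_Iic, not_le] at hx hy
    nlinarith [sq_eq_sq_iff_abs_eq_abs (x - X / 2) (y - X / 2) |>.1 h,
      abs_of_pos (sub_pos.2 hx), abs_of_pos (sub_pos.2 hy)]

theorem lintegral_comp_sub_sq_sub_sq {f : ℝ → ℝ≥0∞} (hf : Measurable f) (c : ℝ) :
    ∫⁻ q : ℝ, ∫⁻ p : ℝ, f (c - p ^ 2 - q ^ 2) ≤ ENNReal.ofReal (2 * Real.pi) * ∫⁻ x, f x := by
  have hm : Measurable fun z : ℝ × ℝ => f (c - z.2 ^ 2 - z.1 ^ 2) := hf.comp (by fun_prop)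
  rw [← lintegral_prod (fun z : ℝ × ℝ => f (c - z.2 ^ 2 - z.1 ^ 2)) hm.aemeasurable,
    ← Measure.volume_eq_prod, ← lintegral_comp_polarCoord_symm]
  have hpt : ∀ p : ℝ × ℝ, f (c - (polarCoord.symm p).2 ^ 2 - (polarCoord.symm p).1 ^ 2) =
      f (c - p.1 ^ 2) := by
    intro p
    simp only [polarCoord_symm_apply]
    congr 1
    linear_combination (-p.1 ^ 2) * Real.sin_sq_add_cos_sq p.2
  simp only [hpt, smul_eq_mul, polarCoord_target, Measure.volume_eq_prod]
  rw [← Measure.prod_restrict, lintegral_prod _ (by fun_prop)]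
  simp only [lintegral_const, MeasurableSet.univ, Measure.restrict_apply, univ_inter,
    Real.volume_Ioo]
  rw [lintegral_mul_const _ (by fun_prop), mul_comm, show Real.pi - -Real.pi = 2 * Real.pi by ring]
  refine mul_le_mul_right ?_ _
  refine mul_setLIntegral_comp_le (φ := fun x => c - x ^ 2) (φ' := fun x => -(2 * x))
    measurableSet_Ioi ?_ ?_ ?_ f
  · intro x _
    simpa using ((hasDerivAt_id x).pow 2).const_sub c
  · intro x hx y hy hxy
    have h : x ^ 2 = y ^ 2 := by simpa using hxy
    exact (sq_eq_sq₀ (le_of_lt hx) (le_of_lt hy)).1 h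
  · intro x hx
    have hx : 0 < x := hx
    rw [abs_neg, abs_of_pos (by positivity)]
    linarith

theorem lintegral_sq_scaled_le (f : ℝ → ℝ≥0∞) (c B : ℝ) (hB : 0 < B) :
    ENNReal.ofReal (√B) * ∫⁻ y, f (B * (y - c) ^ 2) ≤ ∫⁻ q, f (q ^ 2) := by
  refine (lintegral_const_mul_le _ _).trans ?_
  have h := mul_setLIntegral_comp_le (φ := fun y => √B * (y - c)) (φ' := fun _ => √B)
    MeasurableSet.univ (fun x _ => by simpa using ((hasDerivAt_id x).sub_const c).const_mul (√B))
    (fun x _ y _ hxy => by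
      have := mul_left_cancel₀ (Real.sqrt_pos.2 hB).ne' hxy
      linarith) (c := fun _ => √B) (fun x _ => le_abs_self _) (fun q => f (q ^ 2))
  simpa [mul_pow, Real.sq_sqrt hB.le] using h

theorem lintegral_uniformize_le (f : ℝ → ℝ≥0∞) {X : ℝ} (hX : 0 < X) :
    ENNReal.ofReal (√X / 2) * ∫⁻ x in Icc 0 (2 * X / 3),
      f (3 / 4 * (x - X / 3) ^ 2 * (x + 5 * X / 3)) ≤ ∫⁻ p, f (p ^ 2) := by
  refine (lintegral_const_mul_le _ _).trans ?_
  set φ : ℝ → ℝ := fun x => (x - X / 3) * √(3 / 4 * (x + 5 * X / 3))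
  set φ' : ℝ → ℝ := fun x => √(3 / 4 * (x + 5 * X / 3)) +
    (x - X / 3) * (3 / 4 / (2 * √(3 / 4 * (x + 5 * X / 3))))
  have hd : ∀ x ∈ Icc 0 (2 * X / 3), HasDerivAt φ (φ' x) x := by
    intro x hx
    have hpos : 3 / 4 * (x + 5 * X / 3) ≠ 0 := by have := hx.1; positivity
    have h1 : HasDerivAt (fun x : ℝ => 3 / 4 * (x + 5 * X / 3)) (3 / 4) x := by
      simpa using ((hasDerivAt_id x).add_const (5 * X / 3)).const_mul (3 / 4)
    have h2 := ((hasDerivAt_id x).sub_const (X / 3)).mul (h1.sqrt hpos)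
    exact h2.congr_deriv (by simp [φ'])
  have hlow : ∀ x ∈ Icc 0 (2 * X / 3), √X / 2 ≤ φ' x := by
    intro x hx
    have hx0 := hx.1
    have hpos : 0 < 3 / 4 * (x + 5 * X / 3) := by positivity
    set r := √(3 / 4 * (x + 5 * X / 3)) with hr
    have hrpos : 0 < r := Real.sqrt_pos.2 hpos
    have hr2 : r ^ 2 = 3 / 4 * (x + 5 * X / 3) := Real.sq_sqrt hpos.le
    have hle : √X ≤ r := Real.sqrt_le_sqrt (by linarith)
    have e : φ' x = (r ^ 2 + 3 / 8 * (x - X / 3)) / r := by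
      simp only [φ', ← hr]
      field_simp
      ring
    rw [e, le_div_iff₀ hrpos, hr2]
    nlinarith [Real.sqrt_nonneg X]
  have hmono : StrictMonoOn φ (Icc 0 (2 * X / 3)) := by
    refine strictMonoOn_of_deriv_pos (convex_Icc _ _)
      (fun x hx => (hd x hx).continuousAt.continuousWithinAt) fun x hx => ?_
    have hx' := interior_subset hx
    rw [(hd x hx').deriv]
    exact lt_of_lt_of_le (by positivity) (hlow x hx')
  have h := mul_setLIntegral_comp_le measurableSet_Icc hd hmono.injOn (c := fun _ => √X / 2)
    (fun x hx => (hlow x hx).trans (le_abs_self _)) (fun p => f (p ^ 2))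
  refine le_trans (le_of_eq (setLIntegral_congr_fun measurableSet_Icc fun x hx => ?_)) h
  have hpos : 0 ≤ 3 / 4 * (x + 5 * X / 3) := by have := hx.1; positivity
  simp only [φ, mul_pow, Real.sq_sqrt hpos]
  congr 2
  ring

theorem lintegral_resonance_three_half {f : ℝ → ℝ≥0∞} (hf : Measurable f) (T : ℝ) {X : ℝ}
    (hX : 0 < X) :
    ENNReal.ofReal X * ∫⁻ x in Icc 0 (2 * X / 3), ∫⁻ y, f (T - x ^ 3 - y ^ 3 - (X - x - y) ^ 3) ≤
      ENNReal.ofReal (4 * Real.pi) * ∫⁻ x, f x := by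
  have hX2 : ENNReal.ofReal X = 2 * (ENNReal.ofReal (√X / 2) * ENNReal.ofReal (√X)) := by
    rw [← ENNReal.ofReal_mul (by positivity), ← ENNReal.ofReal_ofNat,
      ← ENNReal.ofReal_mul (by positivity)]
    congr 1
    nlinarith [Real.mul_self_sqrt hX.le]
  set A : ℝ → ℝ := fun x => 3 / 4 * (x - X / 3) ^ 2 * (x + 5 * X / 3)
  set T' := T - X ^ 3 / 9
  have hin : ∀ x ∈ Icc 0 (2 * X / 3),
      ENNReal.ofReal (√X) * ∫⁻ y, f (T - x ^ 3 - y ^ 3 - (X - x - y) ^ 3) ≤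
        ∫⁻ q, f (T' - A x - q ^ 2) := by
    intro x hx
    have hB : X ≤ 3 * (X - x) := by linarith [hx.2]
    refine le_trans ?_ (lintegral_sq_scaled_le (fun r => f (T' - A x - r)) ((X - x) / 2)
      (3 * (X - x)) (hX.trans_le hB))
    gcongr with y
    refine le_of_eq (congrArg f ?_)
    simp only [A, T']
    ring
  rw [hX2, mul_assoc, mul_assoc, show 4 * Real.pi = 2 * (2 * Real.pi) by ring,
    ENNReal.ofReal_mul (by positivity), ENNReal.ofReal_ofNat, mul_assoc]
  gcongr 2 * ?_
  calc ENNReal.ofReal (√X / 2) * (ENNReal.ofReal (√X) *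
        ∫⁻ x in Icc 0 (2 * X / 3), ∫⁻ y, f (T - x ^ 3 - y ^ 3 - (X - x - y) ^ 3))
      ≤ ENNReal.ofReal (√X / 2) *
        ∫⁻ x in Icc 0 (2 * X / 3), ∫⁻ q, f (T' - A x - q ^ 2) := by
        gcongr
        exact (lintegral_const_mul_le _ _).trans (setLIntegral_mono' measurableSet_Icc hin)
    _ = ENNReal.ofReal (√X / 2) *
        ∫⁻ q, ∫⁻ x in Icc 0 (2 * X / 3), f (T' - A x - q ^ 2) := by
        rw [lintegral_lintegral_swap]
        exact (hf.comp (by fun_prop)).aemeasurable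
    _ ≤ ∫⁻ q, ENNReal.ofReal (√X / 2) *
        ∫⁻ x in Icc 0 (2 * X / 3), f (T' - A x - q ^ 2) := lintegral_const_mul_le _ _
    _ ≤ ∫⁻ q, ∫⁻ p, f (T' - p ^ 2 - q ^ 2) := by
        gcongr with q
        exact lintegral_uniformize_le (fun r => f (T' - r - q ^ 2)) hX
    _ ≤ _ := lintegral_comp_sub_sq_sub_sq hf T'

theorem lintegral_resonance_three {f : ℝ → ℝ≥0∞} (hf : Measurable f) (T : ℝ) {X : ℝ}
    (hX : 0 < X) :
    ENNReal.ofReal X * ∫⁻ x, ∫⁻ y, (if 0 ≤ x ∧ 0 ≤ y ∧ x + y ≤ X then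
      f (T - x ^ 3 - y ^ 3 - (X - x - y) ^ 3) else 0) ≤
      ENNReal.ofReal (8 * Real.pi) * ∫⁻ x, f x := by
  set g : ℝ → ℝ → ℝ≥0∞ := fun x y => f (T - x ^ 3 - y ^ 3 - (X - x - y) ^ 3)
  have hg : Measurable fun z : ℝ × ℝ => g z.1 z.2 := hf.comp (by fun_prop)
  have hsym : ∀ x y, g x y = g y x := by
    intro x y
    simp only [g]
    congr 1
    ring
  set s := Icc 0 (2 * X / 3)
  have hs : MeasurableSet s := measurableSet_Icc
  have hpt : ∀ x y, (if 0 ≤ x ∧ 0 ≤ y ∧ x + y ≤ X then g x y else 0) ≤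
      s.indicator 1 x * g x y + s.indicator 1 y * g x y := by
    intro x y
    split_ifs with h
    · by_cases hx : x ≤ 2 * X / 3
      · have : x ∈ s := ⟨h.1, hx⟩
        simp [this]
      · have : y ∈ s := ⟨h.2.1, by linarith [h.2.2]⟩
        simp [this]
    · exact zero_le
  have hm1 : Measurable fun z : ℝ × ℝ => s.indicator 1 z.1 * g z.1 z.2 :=
    ((measurable_one.indicator hs).comp measurable_fst).mul hg
  have hm2 : Measurable fun z : ℝ × ℝ => s.indicator 1 z.2 * g z.1 z.2 :=
    ((measurable_one.indicator hs).comp measurable_snd).mul hg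
  have h1 : ∫⁻ x, ∫⁻ y, s.indicator 1 x * g x y = ∫⁻ x in s, ∫⁻ y, g x y := by
    rw [← lintegral_indicator hs]
    congr 1 with x
    by_cases hx : x ∈ s <;> simp [hx]
  have h2 : ∫⁻ x, ∫⁻ y, s.indicator 1 y * g x y = ∫⁻ x in s, ∫⁻ y, g x y := by
    rw [lintegral_lintegral_swap hm2.aemeasurable, ← h1]
    simp_rw [hsym]
  have hmain := lintegral_resonance_three_half hf T hX
  calc ENNReal.ofReal X * ∫⁻ x, ∫⁻ y, (if 0 ≤ x ∧ 0 ≤ y ∧ x + y ≤ X then g x y else 0)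
      ≤ ENNReal.ofReal X * ∫⁻ x, ∫⁻ y, (s.indicator 1 x * g x y + s.indicator 1 y * g x y) := by
        gcongr with x y
        exact hpt x y
    _ = ENNReal.ofReal X * ((∫⁻ x in s, ∫⁻ y, g x y) + ∫⁻ x in s, ∫⁻ y, g x y) := by
        congr 1
        have h3 : ∀ x, ∫⁻ y, (s.indicator 1 x * g x y + s.indicator 1 y * g x y) =
            (∫⁻ y, s.indicator 1 x * g x y) + ∫⁻ y, s.indicator 1 y * g x y :=
          fun x => lintegral_add_left (hm1.comp measurable_prodMk_left) _
        rw [lintegral_congr h3, lintegral_add_left hm1.lintegral_prod_right', h1, h2]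
    _ ≤ _ := by
        rw [mul_add, show 8 * Real.pi = 4 * Real.pi + 4 * Real.pi by ring,
          ENNReal.ofReal_add (by positivity) (by positivity), add_mul]
        exact add_le_add hmain hmain

/-- Convolution of `ℝ≥0∞`-valued functions on the line. -/
def lconv (f g : ℝ → ℝ≥0∞) (t : ℝ) : ℝ≥0∞ := ∫⁻ s, f (t - s) * g s

section lconv

variable {f g : ℝ → ℝ≥0∞}

theorem measurable_lconv (hf : Measurable f) (hg : Measurable g) : Measurable (lconv f g) := by
  have h : Measurable fun z : ℝ × ℝ => f (z.1 - z.2) * g z.2 := by fun_prop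
  exact h.lintegral_prod_right'

theorem lintegral_lconv (hf : Measurable f) (hg : Measurable g) :
    ∫⁻ t, lconv f g t = (∫⁻ t, f t) * ∫⁻ t, g t := by
  unfold lconv
  rw [lintegral_lintegral_swap (by fun_prop), ← lintegral_const_mul _ hg]
  refine lintegral_congr fun s => ?_
  rw [lintegral_mul_const _ (by fun_prop), lintegral_sub_right_eq_self f s]

theorem lconv_le {M : ℝ≥0∞} (hf : ∀ t, f t ≤ M) (hg : Measurable g) (t : ℝ) :
    lconv f g t ≤ M * ∫⁻ s, g s := by
  rw [← lintegral_const_mul _ hg]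
  exact lintegral_mono fun s => mul_le_mul_left (hf _) _

theorem lintegral_shifted_mul (f g : ℝ → ℝ≥0∞) (t p : ℝ) :
    ∫⁻ s, f (t - s) * g (s - p) = lconv f g (t - p) := by
  rw [lconv, ← lintegral_sub_right_eq_self (fun s => f (t - p - s) * g s) p]
  refine lintegral_congr fun s => ?_
  congr 2
  ring

end lconv

/-- The modulation `τ - ξ³`. -/
def modulation (x : ℝ × ℝ) : ℝ := x.1 - x.2 ^ 3

@[fun_prop]
theorem measurable_modulation : Measurable modulation := by unfold modulation; fun_prop

theorem modulation_neg (x : ℝ × ℝ) : modulation (-x) = -modulation x := by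
  simp only [modulation, Prod.fst_neg, Prod.snd_neg]
  ring

/-- The square of the bilinear smoothing multiplier. -/
def smoothSq (ξ η : ℝ) : ℝ≥0∞ := ENNReal.ofReal |ξ ^ 2 - η ^ 2| + (Icc (-1) 1).indicator 1 η

theorem measurable_smoothSq : Measurable fun p : ℝ × ℝ => smoothSq p.1 p.2 := by
  unfold smoothSq
  have : Measurable ((Icc (-1 : ℝ) 1).indicator (1 : ℝ → ℝ≥0∞)) :=
    measurable_one.indicator measurableSet_Icc
  fun_prop

section ModulationIntegrals

variable {ω : ℝ → ℝ≥0∞}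

theorem lintegral_smoothSq_le (hω : Measurable ω) (hω1 : ∀ t, ω t ≤ 1) (z : ℝ × ℝ) :
    ∫⁻ y, smoothSq (z - y).2 y.2 * (ω (modulation (z - y)) * ω (modulation y)) ≤
      2 * (∫⁻ t, ω t) ^ 2 + 2 * ∫⁻ t, ω t := by
  obtain ⟨T, X⟩ := z
  have hm := measurable_smoothSq
  have hm' : Measurable fun y : ℝ × ℝ => smoothSq ((T, X) - y).2 y.2 :=
    hm.comp (f := fun y : ℝ × ℝ => (((T, X) - y).2, y.2)) (by fun_prop)
  rw [Measure.volume_eq_prod, lintegral_prod_symm _ (by fun_prop)]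
  have hin : ∀ ξ : ℝ, ∫⁻ τ : ℝ, smoothSq ((T, X) - (τ, ξ)).2 (τ, ξ).2 *
      (ω (modulation ((T, X) - (τ, ξ))) * ω (modulation (τ, ξ))) =
      smoothSq (X - ξ) ξ * lconv ω ω (T - ξ ^ 3 - (X - ξ) ^ 3) := by
    intro ξ
    have e : T - ξ ^ 3 - (X - ξ) ^ 3 = T - (X - ξ) ^ 3 - ξ ^ 3 := by ring
    rw [e, ← lintegral_shifted_mul, ← lintegral_const_mul _ (by fun_prop)]
    refine lintegral_congr fun τ => ?_
    simp only [Prod.mk_sub_mk, modulation]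
    rw [show T - τ - (X - ξ) ^ 3 = T - (X - ξ) ^ 3 - τ by ring]
  have hc := measurable_lconv hω hω
  have hind : Measurable ((Icc (-1 : ℝ) 1).indicator (1 : ℝ → ℝ≥0∞)) :=
    measurable_one.indicator measurableSet_Icc
  rw [lintegral_congr hin]
  simp only [smoothSq, add_mul]
  rw [lintegral_add_left (by fun_prop)]
  refine add_le_add ?_ ?_
  · have h := lintegral_resonance_two (lconv ω ω) T X
    rw [lintegral_lconv hω hω, ← sq] at h
    refine le_trans (le_of_eq (lintegral_congr fun ξ => ?_)) h
    rw [abs_sub_comm]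
  · have hle : ∀ ξ : ℝ, (Icc (-1 : ℝ) 1).indicator 1 ξ * lconv ω ω (T - ξ ^ 3 - (X - ξ) ^ 3) ≤
        (Icc (-1 : ℝ) 1).indicator (fun _ => ∫⁻ t, ω t) ξ := by
      intro ξ
      by_cases h : ξ ∈ Icc (-1 : ℝ) 1
      · simpa [h] using lconv_le hω1 hω (T - ξ ^ 3 - (X - ξ) ^ 3)
      · simp [h]
    refine (lintegral_mono hle).trans (le_of_eq ?_)
    rw [lintegral_indicator measurableSet_Icc, setLIntegral_const, Real.volume_Icc, mul_comm]
    norm_num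

/-- Indicator of the set of frequencies which are all nonnegative. -/
def posInd (ξ : ℝ) : ℝ≥0∞ := (Ici (0 : ℝ)).indicator 1 ξ

@[fun_prop]
theorem measurable_posInd : Measurable posInd := measurable_one.indicator measurableSet_Ici

theorem posInd_mul_three (x y X : ℝ) : posInd x * (posInd y * posInd (X - x - y)) =
    if 0 ≤ x ∧ 0 ≤ y ∧ x + y ≤ X then 1 else 0 := by
  have h : 0 ≤ X - x - y ↔ x + y ≤ X := by constructor <;> intro h <;> linarith
  by_cases h1 : 0 ≤ x <;> by_cases h2 : 0 ≤ y <;> by_cases h3 : x + y ≤ X <;>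
    simp [posInd, indicator, h, h1, h2, h3]

theorem lintegral_positive_frequencies_le {f : ℝ → ℝ≥0∞} (hf : Measurable f) {M : ℝ≥0∞}
    (hM : ∀ t, f t ≤ M) (T X : ℝ) :
    ∫⁻ x, ∫⁻ y, ENNReal.ofReal (1 + |x|) * (posInd x * (posInd y * posInd (X - x - y))) *
      f (T - x ^ 3 - y ^ 3 - (X - x - y) ^ 3) ≤
      2 * (ENNReal.ofReal (8 * Real.pi) * ∫⁻ x, f x) + 2 * M := by
  simp only [posInd_mul_three]
  rcases le_or_gt X 1 with hX | hX
  · refine le_trans ?_ le_add_self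
    have hle : ∀ x y : ℝ, ENNReal.ofReal (1 + |x|) *
        (if 0 ≤ x ∧ 0 ≤ y ∧ x + y ≤ X then 1 else 0) *
        f (T - x ^ 3 - y ^ 3 - (X - x - y) ^ 3) ≤
        (Icc (0 : ℝ) 1).indicator (fun x => (Icc (0 : ℝ) 1).indicator (fun _ => 2 * M) y) x := by
      intro x y
      split_ifs with h
      · have hx : x ∈ Icc (0 : ℝ) 1 := ⟨h.1, by linarith [h.2.1, h.2.2]⟩
        have hy : y ∈ Icc (0 : ℝ) 1 := ⟨h.2.1, by linarith [h.1, h.2.2]⟩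
        rw [indicator_of_mem hx, indicator_of_mem hy, mul_one]
        gcongr
        · rw [← ENNReal.ofReal_ofNat, abs_of_nonneg h.1]
          exact ENNReal.ofReal_le_ofReal (by linarith [hx.2])
        · exact hM _
      · simp
    refine (lintegral_mono fun x => lintegral_mono fun y => hle x y).trans (le_of_eq ?_)
    have h1 : ∀ x : ℝ, ∫⁻ y : ℝ,
        (Icc (0 : ℝ) 1).indicator (fun x => (Icc (0 : ℝ) 1).indicator (fun _ => 2 * M) y) x =
        (Icc (0 : ℝ) 1).indicator (fun _ => 2 * M) x := by
      intro x
      by_cases hx : x ∈ Icc (0 : ℝ) 1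
      · simp [hx, lintegral_indicator measurableSet_Icc]
      · simp [hx]
    rw [lintegral_congr h1, lintegral_indicator measurableSet_Icc]
    simp
  · refine le_trans ?_ le_self_add
    refine le_trans ?_ (mul_le_mul_right (lintegral_resonance_three hf T (by linarith : 0 < X)) 2)
    have hc : 2 * ENNReal.ofReal X ≠ ⊤ := by finiteness
    rw [← mul_assoc, ← lintegral_const_mul' _ _ hc]
    refine lintegral_mono fun x => ?_
    rw [← lintegral_const_mul' _ _ hc]
    refine lintegral_mono fun y => ?_
    split_ifs with h
    · rw [mul_one, ← ENNReal.ofReal_ofNat, ← ENNReal.ofReal_mul (by norm_num), abs_of_nonneg h.1]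
      gcongr
      linarith [h.2.1, h.2.2]
    · simp

theorem lintegral_trilinear_kernel_le (hω : Measurable ω) (hω1 : ∀ t, ω t ≤ 1) (z : ℝ × ℝ) :
    ∫⁻ x : ℝ × ℝ, ∫⁻ y : ℝ × ℝ,
      (ENNReal.ofReal (1 + |x.2|) * (posInd x.2 * (posInd y.2 * posInd (z - x - y).2))) *
        (ω (modulation x) * (ω (modulation y) * ω (modulation (z - x - y)))) ≤
      2 * (ENNReal.ofReal (8 * Real.pi) * (∫⁻ t, ω t) ^ 3) + 2 * (∫⁻ t, ω t) ^ 2 := by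
  obtain ⟨T, X⟩ := z
  set κ : ℝ → ℝ → ℝ≥0∞ := fun ξ η =>
    ENNReal.ofReal (1 + |ξ|) * (posInd ξ * (posInd η * posInd (X - ξ - η)))
  have hκ : Measurable fun p : ℝ × ℝ => κ p.1 p.2 := by fun_prop
  set W : ℝ → ℝ → ℝ → ℝ → ℝ≥0∞ := fun τ ξ ρ η => κ ξ η *
    (ω (τ - ξ ^ 3) * (ω (ρ - η ^ 3) * ω (T - τ - ρ - (X - ξ - η) ^ 3)))
  have hW : Measurable fun p : (ℝ × ℝ) × (ℝ × ℝ) => W p.1.1 p.1.2 p.2.1 p.2.2 := by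
    have : Measurable fun p : (ℝ × ℝ) × (ℝ × ℝ) => κ p.1.2 p.2.2 :=
      hκ.comp (f := fun p : (ℝ × ℝ) × (ℝ × ℝ) => (p.1.2, p.2.2)) (by fun_prop)
    fun_prop
  have hc := measurable_lconv hω hω
  have e1 : ∫⁻ x : ℝ × ℝ, ∫⁻ y : ℝ × ℝ, W x.1 x.2 y.1 y.2 =
      ∫⁻ ξ, ∫⁻ η, ∫⁻ τ, ∫⁻ ρ, W τ ξ ρ η := by
    have hy : ∀ x : ℝ × ℝ, ∫⁻ y : ℝ × ℝ, W x.1 x.2 y.1 y.2 = ∫⁻ η, ∫⁻ ρ, W x.1 x.2 ρ η := by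
      intro x
      rw [Measure.volume_eq_prod, lintegral_prod_symm]
      exact (hW.comp (f := fun y : ℝ × ℝ => (x, y)) (by fun_prop)).aemeasurable
    rw [Measure.volume_eq_prod, lintegral_prod_symm _ hW.lintegral_prod_right'.aemeasurable]
    refine lintegral_congr fun ξ => ?_
    rw [← Measure.volume_eq_prod, lintegral_congr fun τ => hy (τ, ξ),
      lintegral_lintegral_swap]
    have : Measurable fun p : (ℝ × ℝ) × ℝ => W p.1.1 ξ p.2 p.1.2 :=
      hW.comp (f := fun p : (ℝ × ℝ) × ℝ => ((p.1.1, ξ), (p.2, p.1.2))) (by fun_prop)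
    exact this.lintegral_prod_right'.aemeasurable
  have e2 : ∀ ξ η, ∫⁻ τ, ∫⁻ ρ, W τ ξ ρ η =
      κ ξ η * lconv (lconv ω ω) ω (T - ξ ^ 3 - η ^ 3 - (X - ξ - η) ^ 3) := by
    intro ξ η
    have e : T - ξ ^ 3 - η ^ 3 - (X - ξ - η) ^ 3 = T - (X - ξ - η) ^ 3 - η ^ 3 - ξ ^ 3 := by ring
    rw [e, ← lintegral_shifted_mul, ← lintegral_const_mul _ (by fun_prop)]
    refine lintegral_congr fun τ => ?_
    rw [show T - (X - ξ - η) ^ 3 - η ^ 3 - τ = T - (X - ξ - η) ^ 3 - τ - η ^ 3 by ring,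
      ← lintegral_shifted_mul, ← lintegral_mul_const _ (by fun_prop),
      ← lintegral_const_mul _ (by fun_prop)]
    refine lintegral_congr fun ρ => ?_
    simp only [W]
    rw [show T - τ - ρ - (X - ξ - η) ^ 3 = T - (X - ξ - η) ^ 3 - τ - ρ by ring]
    ring
  have h := lintegral_positive_frequencies_le (measurable_lconv hc hω)
    (lconv_le (lconv_le hω1 hω) hω) T X
  rw [lintegral_lconv hc hω, lintegral_lconv hω hω] at h
  calc _ = ∫⁻ x : ℝ × ℝ, ∫⁻ y : ℝ × ℝ, W x.1 x.2 y.1 y.2 := rfl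
    _ = _ := e1
    _ = _ := lintegral_congr fun ξ => lintegral_congr fun η => e2 ξ η
    _ ≤ _ := h
    _ = _ := by ring

end ModulationIntegrals

section CauchySchwarz

theorem sq_lintegral_mul_le {α : Type*} [MeasurableSpace α] {μ : Measure α} {f g : α → ℝ≥0∞}
    (hf : AEMeasurable f μ) (hg : AEMeasurable g μ) :
    (∫⁻ a, f a * g a ∂μ) ^ 2 ≤ (∫⁻ a, f a ^ 2 ∂μ) * ∫⁻ a, g a ^ 2 ∂μ := by
  have h := ENNReal.lintegral_mul_le_Lp_mul_Lq μ Real.HolderConjugate.two_two hf hg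
  simp only [Pi.mul_apply, ENNReal.rpow_two] at h
  refine (pow_le_pow_left₀ zero_le h 2).trans (le_of_eq ?_)
  rw [mul_pow, ← ENNReal.rpow_natCast, ← ENNReal.rpow_natCast, ← ENNReal.rpow_mul,
    ← ENNReal.rpow_mul]
  norm_num

theorem ENNReal_add_sq_le (a b : ℝ≥0∞) : (a + b) ^ 2 ≤ 2 * a ^ 2 + 2 * b ^ 2 := by
  have h := ENNReal.rpow_add_le_mul_rpow_add_rpow a b (p := 2) (by norm_num)
  norm_num at h
  rwa [mul_add] at h

end CauchySchwarz

section TripleConvolution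

/-- The triple convolution of nonnegative functions on the plane. -/
def tri (F₁ F₂ F₃ : ℝ × ℝ → ℝ≥0∞) (z : ℝ × ℝ) : ℝ≥0∞ :=
  ∫⁻ x, ∫⁻ y, F₁ x * (F₂ y * F₃ (z - x - y))

variable {F F₁ F₂ F₃ : ℝ × ℝ → ℝ≥0∞}

theorem measurable_tri (h₁ : Measurable F₁) (h₂ : Measurable F₂) (h₃ : Measurable F₃) :
    Measurable (tri F₁ F₂ F₃) := by
  have h : Measurable fun p : ((ℝ × ℝ) × (ℝ × ℝ)) × (ℝ × ℝ) =>
      F₁ p.1.2 * (F₂ p.2 * F₃ (p.1.1 - p.1.2 - p.2)) := by fun_prop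
  exact h.lintegral_prod_right'.lintegral_prod_right'

theorem tri_swap_left (h₁ : Measurable F₁) (h₂ : Measurable F₂) (h₃ : Measurable F₃) :
    tri F₁ F₂ F₃ = tri F₂ F₁ F₃ := by
  ext z
  unfold tri
  rw [lintegral_lintegral_swap (by fun_prop)]
  refine lintegral_congr fun x => lintegral_congr fun y => ?_
  rw [sub_right_comm]
  ring

theorem tri_swap_right : tri F₁ F₂ F₃ = tri F₁ F₃ F₂ := by
  ext z
  unfold tri
  refine lintegral_congr fun x => ?_
  rw [← lintegral_sub_left_eq_self (fun y => F₁ x * (F₃ y * F₂ (z - x - y))) (z - x)]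
  refine lintegral_congr fun y => ?_
  rw [sub_sub_cancel, mul_comm (F₂ y)]

theorem tri_add_left {F₁' : ℝ × ℝ → ℝ≥0∞} (h₁ : Measurable F₁) (h₂ : Measurable F₂)
    (h₃ : Measurable F₃) (z : ℝ × ℝ) :
    tri (F₁ + F₁') F₂ F₃ z = tri F₁ F₂ F₃ z + tri F₁' F₂ F₃ z := by
  unfold tri
  have h : Measurable fun p : (ℝ × ℝ) × (ℝ × ℝ) => F₁ p.1 * (F₂ p.2 * F₃ (z - p.1 - p.2)) := by
    fun_prop
  rw [← lintegral_add_left h.lintegral_prod_right']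
  refine lintegral_congr fun x => ?_
  rw [← lintegral_add_left (by fun_prop)]
  simp only [Pi.add_apply, add_mul]

theorem lintegral_tri_add_sq_le {F₁' : ℝ × ℝ → ℝ≥0∞} (h₁ : Measurable F₁)
    (h₂ : Measurable F₂) (h₃ : Measurable F₃) :
    ∫⁻ z, tri (F₁ + F₁') F₂ F₃ z ^ 2 ≤
      2 * (∫⁻ z, tri F₁ F₂ F₃ z ^ 2) + 2 * ∫⁻ z, tri F₁' F₂ F₃ z ^ 2 := by
  have hm := measurable_tri h₁ h₂ h₃
  rw [← lintegral_const_mul' _ _ (by simp), ← lintegral_const_mul' _ _ (by simp),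
    ← lintegral_add_left (by fun_prop)]
  refine lintegral_mono fun z => ?_
  rw [tri_add_left h₁ h₂ h₃]
  exact ENNReal_add_sq_le _ _

theorem lintegral_conv_sq {P : ℝ × ℝ → ℝ≥0∞} (hF : Measurable F) (hP : Measurable P) :
    ∫⁻ z, (∫⁻ x, F x * P (z - x)) ^ 2 =
      ∫⁻ x, ∫⁻ y, F x * F y * ∫⁻ z, P (z - x) * P (z - y) := by
  have h1 : ∀ z, (∫⁻ x, F x * P (z - x)) ^ 2 =
      ∫⁻ x, ∫⁻ y, F x * F y * (P (z - x) * P (z - y)) := by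
    intro z
    rw [sq, ← lintegral_mul_const _ (by fun_prop)]
    refine lintegral_congr fun x => ?_
    rw [← lintegral_const_mul _ (by fun_prop)]
    refine lintegral_congr fun y => ?_
    ring
  have h : Measurable fun p : ((ℝ × ℝ) × (ℝ × ℝ)) × (ℝ × ℝ) =>
      F p.1.2 * F p.2 * (P (p.1.1 - p.1.2) * P (p.1.1 - p.2)) := by fun_prop
  rw [lintegral_congr h1, lintegral_lintegral_swap h.lintegral_prod_right'.aemeasurable]
  refine lintegral_congr fun x => ?_
  rw [lintegral_lintegral_swap (by fun_prop)]
  refine lintegral_congr fun y => ?_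
  rw [lintegral_const_mul _ (by fun_prop)]

theorem lintegral_conv_neg_sq {P : ℝ × ℝ → ℝ≥0∞} (hF : Measurable F) (hP : Measurable P) :
    ∫⁻ z, (∫⁻ x, F (-x) * P (z - x)) ^ 2 = ∫⁻ z, (∫⁻ x, F x * P (z - x)) ^ 2 := by
  rw [lintegral_conv_sq hF hP, lintegral_conv_sq (F := fun x => F (-x)) (by fun_prop) hP,
    ← lintegral_neg_eq_self]
  refine lintegral_congr fun x => ?_
  rw [← lintegral_neg_eq_self]
  refine lintegral_congr fun y => ?_
  rw [neg_neg, neg_neg, ← lintegral_add_right_eq_self (fun z => P (z - x) * P (z - y)) (x + y)]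
  congr 1
  refine lintegral_congr fun z => ?_
  rw [mul_comm]
  congr 2 <;> abel

theorem tri_eq_conv (h₂ : Measurable F₂) (h₃ : Measurable F₃) (z : ℝ × ℝ) :
    tri F₁ F₂ F₃ z = ∫⁻ x, F₁ x * ∫⁻ y, F₂ y * F₃ (z - x - y) := by
  refine lintegral_congr fun x => ?_
  rw [lintegral_const_mul _ (by fun_prop)]

theorem lintegral_tri_neg_sq (h₁ : Measurable F₁) (h₂ : Measurable F₂) (h₃ : Measurable F₃) :
    ∫⁻ z, tri (fun x => F₁ (-x)) F₂ F₃ z ^ 2 = ∫⁻ z, tri F₁ F₂ F₃ z ^ 2 := by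
  simp only [tri_eq_conv h₂ h₃]
  have h : Measurable fun p : (ℝ × ℝ) × (ℝ × ℝ) => F₂ p.2 * F₃ (p.1 - p.2) := by fun_prop
  exact lintegral_conv_neg_sq h₁ h.lintegral_prod_right'

theorem tri_eq_lintegral_prod (h₁ : Measurable F₁) (h₂ : Measurable F₂) (h₃ : Measurable F₃)
    (z : ℝ × ℝ) : tri F₁ F₂ F₃ z =
      ∫⁻ p : (ℝ × ℝ) × (ℝ × ℝ), F₁ p.1 * (F₂ p.2 * F₃ (z - p.1 - p.2)) := by
  rw [Measure.volume_eq_prod, lintegral_prod _ (by fun_prop)]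
  rfl

theorem lintegral_tri (h₁ : Measurable F₁) (h₂ : Measurable F₂) (h₃ : Measurable F₃) :
    ∫⁻ z, tri F₁ F₂ F₃ z = (∫⁻ x, F₁ x) * ((∫⁻ x, F₂ x) * ∫⁻ x, F₃ x) := by
  have h : Measurable fun p : ((ℝ × ℝ) × (ℝ × ℝ)) × (ℝ × ℝ) =>
      F₁ p.1.2 * (F₂ p.2 * F₃ (p.1.1 - p.1.2 - p.2)) := by fun_prop
  simp only [tri]
  rw [lintegral_lintegral_swap h.lintegral_prod_right'.aemeasurable,
    ← lintegral_mul_const _ (by fun_prop)]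
  refine lintegral_congr fun x => ?_
  rw [lintegral_lintegral_swap (by fun_prop), ← lintegral_mul_const _ (by fun_prop),
    ← lintegral_const_mul _ (by fun_prop)]
  refine lintegral_congr fun y => ?_
  rw [lintegral_const_mul _ (by fun_prop), lintegral_const_mul _ (by fun_prop)]
  congr 2
  rw [lintegral_sub_right_eq_self (fun z => F₃ (z - y)) x,
    lintegral_sub_right_eq_self F₃ y]

theorem tri_mul_sq_le {v₁ v₂ v₃ f₁ f₂ f₃ : ℝ × ℝ → ℝ≥0∞} (hv₁ : Measurable v₁)
    (hv₂ : Measurable v₂) (hv₃ : Measurable v₃) (h₁ : Measurable f₁) (h₂ : Measurable f₂)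
    (h₃ : Measurable f₃) (z : ℝ × ℝ) :
    tri (v₁ * f₁) (v₂ * f₂) (v₃ * f₃) z ^ 2 ≤
      tri (v₁ ^ 2) (v₂ ^ 2) (v₃ ^ 2) z * tri (f₁ ^ 2) (f₂ ^ 2) (f₃ ^ 2) z := by
  have hcs := sq_lintegral_mul_le (μ := (volume : Measure ((ℝ × ℝ) × (ℝ × ℝ))))
    (f := fun p => v₁ p.1 * (v₂ p.2 * v₃ (z - p.1 - p.2)))
    (g := fun p => f₁ p.1 * (f₂ p.2 * f₃ (z - p.1 - p.2)))
    (Measurable.aemeasurable (by fun_prop)) (Measurable.aemeasurable (by fun_prop))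
  rw [tri_eq_lintegral_prod (hv₁.mul h₁) (hv₂.mul h₂) (hv₃.mul h₃),
    tri_eq_lintegral_prod (F₁ := v₁ ^ 2) (F₂ := v₂ ^ 2) (F₃ := v₃ ^ 2) (hv₁.pow_const 2)
      (hv₂.pow_const 2) (hv₃.pow_const 2),
    tri_eq_lintegral_prod (F₁ := f₁ ^ 2) (F₂ := f₂ ^ 2) (F₃ := f₃ ^ 2) (h₁.pow_const 2)
      (h₂.pow_const 2) (h₃.pow_const 2)]
  simp only [Pi.mul_apply, Pi.pow_apply]
  simp only [mul_pow] at hcs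
  refine le_trans (le_of_eq ?_) hcs
  congr 1
  refine lintegral_congr fun p => ?_
  ring

theorem lintegral_tri_mul_sq_le {v₁ v₂ v₃ f₁ f₂ f₃ : ℝ × ℝ → ℝ≥0∞} (hv₁ : Measurable v₁)
    (hv₂ : Measurable v₂) (hv₃ : Measurable v₃) (h₁ : Measurable f₁) (h₂ : Measurable f₂)
    (h₃ : Measurable f₃) {C : ℝ≥0∞} (hC : ∀ z, tri (v₁ ^ 2) (v₂ ^ 2) (v₃ ^ 2) z ≤ C) :
    ∫⁻ z, tri (v₁ * f₁) (v₂ * f₂) (v₃ * f₃) z ^ 2 ≤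
      C * ((∫⁻ x, f₁ x ^ 2) * ((∫⁻ x, f₂ x ^ 2) * ∫⁻ x, f₃ x ^ 2)) := by
  have h₁' : Measurable (f₁ ^ 2) := h₁.pow_const 2
  have h₂' : Measurable (f₂ ^ 2) := h₂.pow_const 2
  have h₃' : Measurable (f₃ ^ 2) := h₃.pow_const 2
  refine (lintegral_mono fun z => (tri_mul_sq_le hv₁ hv₂ hv₃ h₁ h₂ h₃ z).trans
    (mul_le_mul_left (hC z) _)).trans (le_of_eq ?_)
  rw [lintegral_const_mul _ (measurable_tri h₁' h₂' h₃'), lintegral_tri h₁' h₂' h₃']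
  simp only [Pi.pow_apply]

end TripleConvolution

section SignReduction

/-- The part of `f` supported on nonnegative frequencies. -/
def posFreq (f : ℝ × ℝ → ℝ≥0∞) (x : ℝ × ℝ) : ℝ≥0∞ := posInd x.2 * f x

theorem measurable_posFreq {f : ℝ × ℝ → ℝ≥0∞} (hf : Measurable f) : Measurable (posFreq f) := by
  unfold posFreq
  fun_prop

theorem le_of_posFreq_le {Φ : (ℝ × ℝ → ℝ≥0∞) → ℝ≥0∞} {C : ℝ≥0∞}
    (hadd : ∀ f g, Measurable f → Measurable g → Φ (f + g) ≤ 2 * Φ f + 2 * Φ g)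
    (hneg : ∀ f, Measurable f → Φ (fun x => f (-x)) = Φ f)
    (hpos : ∀ f, Measurable f → Φ (posFreq f) ≤ C * ∫⁻ x, f x ^ 2)
    {f : ℝ × ℝ → ℝ≥0∞} (hf : Measurable f) : Φ f ≤ 2 * C * ∫⁻ x, f x ^ 2 := by
  set s : Set (ℝ × ℝ) := {x | 0 ≤ x.2}
  have hs : MeasurableSet s := measurableSet_le measurable_const measurable_snd
  set p := s.indicator f
  set n := sᶜ.indicator f
  have hp : Measurable p := hf.indicator hs
  have hn : Measurable n := hf.indicator hs.compl
  have e1 : posFreq p = p := by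
    ext x
    by_cases hx : 0 ≤ x.2 <;> simp [posFreq, posInd, p, s, hx]
  have e2 : posFreq (fun x => n (-x)) = fun x => n (-x) := by
    ext x
    by_cases hx : 0 ≤ x.2
    · simp [posFreq, posInd, hx]
    · have : -x ∈ s := by simp only [s, mem_ofPred_eq, Prod.snd_neg]; linarith
      simp [posFreq, posInd, n, this]
  have hsum : p + n = f := indicator_self_add_compl s f
  have h1 := hpos p hp
  have h2 := hpos (fun x => n (-x)) (by fun_prop)
  rw [e1] at h1
  rw [e2, hneg n hn, lintegral_neg_eq_self (fun x => n x ^ 2)] at h2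
  have hE : (∫⁻ x, p x ^ 2) + ∫⁻ x, n x ^ 2 = ∫⁻ x, f x ^ 2 := by
    rw [← lintegral_add_left (by fun_prop)]
    refine lintegral_congr fun x => ?_
    by_cases hx : x ∈ s <;> simp [p, n, hx]
  calc Φ f = Φ (p + n) := by rw [hsum]
    _ ≤ 2 * Φ p + 2 * Φ n := hadd p n hp hn
    _ ≤ 2 * (C * ∫⁻ x, p x ^ 2) + 2 * (C * ∫⁻ x, n x ^ 2) := by gcongr
    _ = 2 * C * ∫⁻ x, f x ^ 2 := by rw [← hE]; ring

/-- Sign reduction in the first factor of a triple convolution with an even weight. -/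
theorem lintegral_tri_sq_le_of_posFreq {v F₂ F₃ : ℝ × ℝ → ℝ≥0∞} (hv : Measurable v)
    (hve : ∀ x, v (-x) = v x) (h₂ : Measurable F₂) (h₃ : Measurable F₃) {C : ℝ≥0∞}
    (hpos : ∀ f, Measurable f →
      ∫⁻ z, tri (v * posFreq f) F₂ F₃ z ^ 2 ≤ C * ∫⁻ x, f x ^ 2)
    {f : ℝ × ℝ → ℝ≥0∞} (hf : Measurable f) :
    ∫⁻ z, tri (v * f) F₂ F₃ z ^ 2 ≤ 2 * C * ∫⁻ x, f x ^ 2 := by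
  refine le_of_posFreq_le (Φ := fun f => ∫⁻ z, tri (v * f) F₂ F₃ z ^ 2) ?_ ?_ hpos hf
  · intro f g hf _
    rw [mul_add]
    exact lintegral_tri_add_sq_le (by fun_prop) h₂ h₃
  · intro f hf
    have e : (v * fun x => f (-x)) = fun x => (v * f) (-x) := by
      ext x
      simp [hve]
    simp only [e]
    exact lintegral_tri_neg_sq (by fun_prop) h₂ h₃

theorem lintegral_tri_sq_le {v₁ v₂ v₃ : ℝ × ℝ → ℝ≥0∞} (hv₁ : Measurable v₁)
    (hv₂ : Measurable v₂) (hv₃ : Measurable v₃) (he₁ : ∀ x, v₁ (-x) = v₁ x)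
    (he₂ : ∀ x, v₂ (-x) = v₂ x) (he₃ : ∀ x, v₃ (-x) = v₃ x) {C : ℝ≥0∞}
    (hC : ∀ z, tri (posFreq v₁ ^ 2) (posFreq v₂ ^ 2) (posFreq v₃ ^ 2) z ≤ C)
    {f₁ f₂ f₃ : ℝ × ℝ → ℝ≥0∞} (h₁ : Measurable f₁) (h₂ : Measurable f₂) (h₃ : Measurable f₃) :
    ∫⁻ z, tri (v₁ * f₁) (v₂ * f₂) (v₃ * f₃) z ^ 2 ≤
      8 * C * ((∫⁻ x, f₁ x ^ 2) * ((∫⁻ x, f₂ x ^ 2) * ∫⁻ x, f₃ x ^ 2)) := by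
  have hcomm : ∀ v f : ℝ × ℝ → ℝ≥0∞, v * posFreq f = posFreq v * f := by
    intro v f
    ext x
    simp only [Pi.mul_apply, posFreq]
    ring
  have hm : ∀ {v f : ℝ × ℝ → ℝ≥0∞}, Measurable v → Measurable f → Measurable (v * posFreq f) :=
    fun hv hf => hv.mul (measurable_posFreq hf)
  have step1 : ∀ {f₁ f₂ f₃ : ℝ × ℝ → ℝ≥0∞}, Measurable f₁ → Measurable f₂ → Measurable f₃ →
      ∫⁻ z, tri (v₁ * f₁) (v₂ * posFreq f₂) (v₃ * posFreq f₃) z ^ 2 ≤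
        2 * (C * ((∫⁻ x, f₂ x ^ 2) * ∫⁻ x, f₃ x ^ 2)) * ∫⁻ x, f₁ x ^ 2 := by
    intro f₁ f₂ f₃ h₁ h₂ h₃
    refine lintegral_tri_sq_le_of_posFreq hv₁ he₁ (hm hv₂ h₂) (hm hv₃ h₃) ?_ h₁
    intro f hf
    rw [hcomm, hcomm, hcomm]
    refine (lintegral_tri_mul_sq_le (measurable_posFreq hv₁) (measurable_posFreq hv₂)
      (measurable_posFreq hv₃) hf h₂ h₃ hC).trans (le_of_eq ?_)
    ring
  have step2 : ∀ {f₁ f₂ f₃ : ℝ × ℝ → ℝ≥0∞}, Measurable f₁ → Measurable f₂ → Measurable f₃ →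
      ∫⁻ z, tri (v₁ * f₁) (v₂ * f₂) (v₃ * posFreq f₃) z ^ 2 ≤
        2 * (2 * C * ((∫⁻ x, f₁ x ^ 2) * ∫⁻ x, f₃ x ^ 2)) * ∫⁻ x, f₂ x ^ 2 := by
    intro f₁ f₂ f₃ h₁ h₂ h₃
    rw [tri_swap_left (hv₁.mul h₁) (hv₂.mul h₂) (hm hv₃ h₃)]
    refine lintegral_tri_sq_le_of_posFreq hv₂ he₂ (hv₁.mul h₁) (hm hv₃ h₃) ?_ h₂
    intro f hf
    rw [tri_swap_left (hm hv₂ hf) (hv₁.mul h₁) (hm hv₃ h₃)]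
    refine (step1 h₁ hf h₃).trans (le_of_eq ?_)
    ring
  rw [tri_swap_right, tri_swap_left (hv₁.mul h₁) (hv₃.mul h₃) (hv₂.mul h₂)]
  refine (lintegral_tri_sq_le_of_posFreq hv₃ he₃ (hv₁.mul h₁) (hv₂.mul h₂)
    (C := 4 * C * ((∫⁻ x, f₁ x ^ 2) * ∫⁻ x, f₂ x ^ 2)) ?_ h₃).trans (le_of_eq ?_)
  · intro f hf
    rw [tri_swap_left (hm hv₃ hf) (hv₁.mul h₁) (hv₂.mul h₂), tri_swap_right]
    refine (step2 h₁ h₂ hf).trans (le_of_eq ?_)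
    ring
  · ring

end SignReduction

section FiveLinearForm

/-- The point of the zero-sum hyperplane with prescribed last four coordinates. -/
def zeroSum (x₁ x₂ x₃ x₄ : ℝ × ℝ) : Fin 5 → ℝ × ℝ :=
  ![-(x₁ + x₂ + x₃ + x₄), x₁, x₂, x₃, x₄]

/-- Integration over the zero-sum hyperplane in `(ℝ²)⁵`. -/
def zeroSumIntegral (Φ : (Fin 5 → ℝ × ℝ) → ℝ≥0∞) : ℝ≥0∞ :=
  ∫⁻ x₁, ∫⁻ x₂, ∫⁻ x₃, ∫⁻ x₄, Φ (zeroSum x₁ x₂ x₃ x₄)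

theorem sum_zeroSum (x₁ x₂ x₃ x₄ : ℝ × ℝ) : ∑ i, zeroSum x₁ x₂ x₃ x₄ i = 0 := by
  simp only [zeroSum, Fin.sum_univ_five]
  simp
  abel

theorem measurable_zeroSum :
    Measurable fun p : (ℝ × ℝ) × (ℝ × ℝ) × (ℝ × ℝ) × (ℝ × ℝ) =>
      zeroSum p.1 p.2.1 p.2.2.1 p.2.2.2 := by
  refine measurable_pi_lambda _ fun i => ?_
  fin_cases i <;> simp [zeroSum] <;> fun_prop

theorem measurable_zeroSum_comp {α : Type*} [MeasurableSpace α] {x₁ x₂ x₃ x₄ : α → ℝ × ℝ}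
    (h₁ : Measurable x₁) (h₂ : Measurable x₂) (h₃ : Measurable x₃) (h₄ : Measurable x₄) :
    Measurable fun a => zeroSum (x₁ a) (x₂ a) (x₃ a) (x₄ a) :=
  measurable_zeroSum.comp (h₁.prodMk (h₂.prodMk (h₃.prodMk h₄)))

theorem zeroSumIntegral_mono {Φ Ψ : (Fin 5 → ℝ × ℝ) → ℝ≥0∞}
    (h : ∀ x, ∑ i, x i = 0 → Φ x ≤ Ψ x) : zeroSumIntegral Φ ≤ zeroSumIntegral Ψ :=
  lintegral_mono fun _ => lintegral_mono fun _ => lintegral_mono fun _ => lintegral_mono fun _ =>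
    h _ (sum_zeroSum _ _ _ _)

variable {Φ : (Fin 5 → ℝ × ℝ) → ℝ≥0∞}

theorem measurable_zeroSumIntegral_inner₄ (hΦ : Measurable Φ) :
    Measurable fun p : (ℝ × ℝ) × (ℝ × ℝ) × (ℝ × ℝ) =>
      ∫⁻ x₄, Φ (zeroSum p.1 p.2.1 p.2.2 x₄) := by
  have h : Measurable fun p : ((ℝ × ℝ) × (ℝ × ℝ) × (ℝ × ℝ)) × (ℝ × ℝ) =>
      Φ (zeroSum p.1.1 p.1.2.1 p.1.2.2 p.2) :=
    hΦ.comp (measurable_zeroSum_comp (by fun_prop) (by fun_prop) (by fun_prop) (by fun_prop))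
  exact h.lintegral_prod_right'

theorem measurable_zeroSumIntegral_inner₃ (hΦ : Measurable Φ) :
    Measurable fun p : (ℝ × ℝ) × (ℝ × ℝ) =>
      ∫⁻ x₃, ∫⁻ x₄, Φ (zeroSum p.1 p.2 x₃ x₄) := by
  have h : Measurable fun p : ((ℝ × ℝ) × (ℝ × ℝ)) × (ℝ × ℝ) =>
      ∫⁻ x₄, Φ (zeroSum p.1.1 p.1.2 p.2 x₄) :=
    (measurable_zeroSumIntegral_inner₄ hΦ).comp
      (f := fun p : ((ℝ × ℝ) × (ℝ × ℝ)) × (ℝ × ℝ) => (p.1.1, p.1.2, p.2)) (by fun_prop)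
  exact h.lintegral_prod_right'

theorem measurable_zeroSumIntegral_inner₂ (hΦ : Measurable Φ) :
    Measurable fun x₁ => ∫⁻ x₂, ∫⁻ x₃, ∫⁻ x₄, Φ (zeroSum x₁ x₂ x₃ x₄) :=
  (measurable_zeroSumIntegral_inner₃ hΦ).lintegral_prod_right'

theorem measurable_zeroSumIntegral_section₂ (hΦ : Measurable Φ) (x₁ : ℝ × ℝ) :
    Measurable fun x₂ => ∫⁻ x₃, ∫⁻ x₄, Φ (zeroSum x₁ x₂ x₃ x₄) :=
  (measurable_zeroSumIntegral_inner₃ hΦ).comp (f := fun x₂ => (x₁, x₂)) (by fun_prop)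

theorem measurable_zeroSumIntegral_section₃ (hΦ : Measurable Φ) (x₁ x₂ : ℝ × ℝ) :
    Measurable fun x₃ => ∫⁻ x₄, Φ (zeroSum x₁ x₂ x₃ x₄) :=
  (measurable_zeroSumIntegral_inner₄ hΦ).comp (f := fun x₃ => (x₁, x₂, x₃)) (by fun_prop)

theorem measurable_zeroSum_section₄ (hΦ : Measurable Φ) (x₁ x₂ x₃ : ℝ × ℝ) :
    Measurable fun x₄ => Φ (zeroSum x₁ x₂ x₃ x₄) :=
  hΦ.comp (measurable_zeroSum_comp (by fun_prop) (by fun_prop) (by fun_prop) (by fun_prop))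

theorem zeroSumIntegral_const_mul (hΦ : Measurable Φ) (c : ℝ≥0∞) :
    zeroSumIntegral (fun x => c * Φ x) = c * zeroSumIntegral Φ := by
  unfold zeroSumIntegral
  rw [← lintegral_const_mul _ (measurable_zeroSumIntegral_inner₂ hΦ)]
  refine lintegral_congr fun x₁ => ?_
  rw [← lintegral_const_mul _ (measurable_zeroSumIntegral_section₂ hΦ x₁)]
  refine lintegral_congr fun x₂ => ?_
  rw [← lintegral_const_mul _ (measurable_zeroSumIntegral_section₃ hΦ x₁ x₂)]
  refine lintegral_congr fun x₃ => ?_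
  rw [← lintegral_const_mul _ (measurable_zeroSum_section₄ hΦ x₁ x₂ x₃)]

theorem zeroSumIntegral_add (hΦ : Measurable Φ) (Ψ : (Fin 5 → ℝ × ℝ) → ℝ≥0∞) :
    zeroSumIntegral (fun x => Φ x + Ψ x) = zeroSumIntegral Φ + zeroSumIntegral Ψ := by
  unfold zeroSumIntegral
  rw [← lintegral_add_left (measurable_zeroSumIntegral_inner₂ hΦ)]
  refine lintegral_congr fun x₁ => ?_
  rw [← lintegral_add_left (measurable_zeroSumIntegral_section₂ hΦ x₁)]
  refine lintegral_congr fun x₂ => ?_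
  rw [← lintegral_add_left (measurable_zeroSumIntegral_section₃ hΦ x₁ x₂)]
  refine lintegral_congr fun x₃ => ?_
  rw [← lintegral_add_left (measurable_zeroSum_section₄ hΦ x₁ x₂ x₃)]

theorem zeroSumIntegral_sum {ι : Type*} (s : Finset ι) {Ψ : ι → (Fin 5 → ℝ × ℝ) → ℝ≥0∞}
    (hΨ : ∀ i, Measurable (Ψ i)) :
    zeroSumIntegral (fun x => ∑ i ∈ s, Ψ i x) = ∑ i ∈ s, zeroSumIntegral (Ψ i) := by
  classical
  induction s using Finset.induction_on with
  | empty => simp [zeroSumIntegral]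
  | insert a s ha ih =>
    simp only [Finset.sum_insert ha]
    rw [zeroSumIntegral_add (hΨ a), ih]

theorem zeroSumIntegral_swap_one_two (hΦ : Measurable Φ) :
    zeroSumIntegral (fun x => Φ (x ∘ Equiv.swap 1 2)) = zeroSumIntegral Φ := by
  have e : ∀ x₁ x₂ x₃ x₄, zeroSum x₁ x₂ x₃ x₄ ∘ Equiv.swap 1 2 = zeroSum x₂ x₁ x₃ x₄ := by
    intro x₁ x₂ x₃ x₄
    ext i : 1
    fin_cases i <;> simp [zeroSum, Equiv.swap_apply_def]
    abel
  simp only [zeroSumIntegral, e]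
  exact (lintegral_lintegral_swap (f := fun x₁ x₂ => ∫⁻ x₃, ∫⁻ x₄, Φ (zeroSum x₁ x₂ x₃ x₄))
    (measurable_zeroSumIntegral_inner₃ hΦ).aemeasurable).symm

theorem zeroSumIntegral_swap_two_three (hΦ : Measurable Φ) :
    zeroSumIntegral (fun x => Φ (x ∘ Equiv.swap 2 3)) = zeroSumIntegral Φ := by
  have e : ∀ x₁ x₂ x₃ x₄, zeroSum x₁ x₂ x₃ x₄ ∘ Equiv.swap 2 3 = zeroSum x₁ x₃ x₂ x₄ := by
    intro x₁ x₂ x₃ x₄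
    ext i : 1
    fin_cases i <;> simp [zeroSum, Equiv.swap_apply_def]
    abel
  simp only [zeroSumIntegral, e]
  refine lintegral_congr fun x₁ => ?_
  exact (lintegral_lintegral_swap (f := fun x₂ x₃ => ∫⁻ x₄, Φ (zeroSum x₁ x₂ x₃ x₄))
    (((measurable_zeroSumIntegral_inner₄ hΦ).comp
      (f := fun p : (ℝ × ℝ) × (ℝ × ℝ) => (x₁, p.1, p.2)) (by fun_prop)).aemeasurable)).symm

theorem zeroSumIntegral_swap_three_four (hΦ : Measurable Φ) :
    zeroSumIntegral (fun x => Φ (x ∘ Equiv.swap 3 4)) = zeroSumIntegral Φ := by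
  have e : ∀ x₁ x₂ x₃ x₄, zeroSum x₁ x₂ x₃ x₄ ∘ Equiv.swap 3 4 = zeroSum x₁ x₂ x₄ x₃ := by
    intro x₁ x₂ x₃ x₄
    ext i : 1
    fin_cases i <;> simp [zeroSum, Equiv.swap_apply_def]
    abel
  simp only [zeroSumIntegral, e]
  refine lintegral_congr fun x₁ => lintegral_congr fun x₂ => ?_
  exact (lintegral_lintegral_swap (f := fun x₃ x₄ => Φ (zeroSum x₁ x₂ x₃ x₄))
    ((hΦ.comp (measurable_zeroSum_comp (α := (ℝ × ℝ) × (ℝ × ℝ)) (by fun_prop) (by fun_prop)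
      measurable_fst measurable_snd)).aemeasurable)).symm

theorem zeroSumIntegral_swap_zero_four (Φ : (Fin 5 → ℝ × ℝ) → ℝ≥0∞) :
    zeroSumIntegral (fun x => Φ (x ∘ Equiv.swap 0 4)) = zeroSumIntegral Φ := by
  have e : ∀ x₁ x₂ x₃ x₄, zeroSum x₁ x₂ x₃ x₄ ∘ Equiv.swap 0 4 =
      zeroSum x₁ x₂ x₃ (-(x₁ + x₂ + x₃) - x₄) := by
    intro x₁ x₂ x₃ x₄
    ext i : 1
    fin_cases i <;> simp [zeroSum, Equiv.swap_apply_def]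
    abel
  simp only [zeroSumIntegral, e]
  refine lintegral_congr fun x₁ => lintegral_congr fun x₂ => lintegral_congr fun x₃ => ?_
  exact lintegral_sub_left_eq_self (fun x₄ => Φ (zeroSum x₁ x₂ x₃ x₄)) _

/-- The permutations of the coordinates that preserve integration over the hyperplane. -/
def zeroSumSymmetries : Submonoid (Equiv.Perm (Fin 5)) where
  carrier := {σ | ∀ Φ : (Fin 5 → ℝ × ℝ) → ℝ≥0∞, Measurable Φ →
    zeroSumIntegral (fun x => Φ (x ∘ σ)) = zeroSumIntegral Φ}
  one_mem' := fun _ _ => rfl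
  mul_mem' := by
    intro σ τ hσ hτ Φ hΦ
    have h := hσ (fun y => Φ (y ∘ τ)) (hΦ.comp (by fun_prop))
    exact h.trans (hτ Φ hΦ)

theorem zeroSumIntegral_comp_perm (hΦ : Measurable Φ) (σ : Equiv.Perm (Fin 5)) :
    zeroSumIntegral (fun x => Φ (x ∘ σ)) = zeroSumIntegral Φ := by
  suffices h : (⊤ : Submonoid (Equiv.Perm (Fin 5))) ≤ zeroSumSymmetries from
    h (Submonoid.mem_top σ) Φ hΦ
  have h12 : Equiv.swap 1 2 ∈ zeroSumSymmetries := fun Φ hΦ => zeroSumIntegral_swap_one_two hΦ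
  have h23 : Equiv.swap 2 3 ∈ zeroSumSymmetries := fun Φ hΦ => zeroSumIntegral_swap_two_three hΦ
  have h34 : Equiv.swap 3 4 ∈ zeroSumSymmetries := fun Φ hΦ => zeroSumIntegral_swap_three_four hΦ
  have h04 : Equiv.swap 0 4 ∈ zeroSumSymmetries := fun Φ _ => zeroSumIntegral_swap_zero_four Φ
  have h03 : Equiv.swap 0 3 ∈ zeroSumSymmetries := by
    have e : (Equiv.swap 0 3 : Equiv.Perm (Fin 5)) =
      Equiv.swap 3 4 * Equiv.swap 0 4 * Equiv.swap 3 4 := by decide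
    exact e ▸ mul_mem (mul_mem h34 h04) h34
  have h02 : Equiv.swap 0 2 ∈ zeroSumSymmetries := by
    have e : (Equiv.swap 0 2 : Equiv.Perm (Fin 5)) =
      Equiv.swap 2 3 * Equiv.swap 0 3 * Equiv.swap 2 3 := by decide
    exact e ▸ mul_mem (mul_mem h23 h03) h23
  have h01 : Equiv.swap 0 1 ∈ zeroSumSymmetries := by
    have e : (Equiv.swap 0 1 : Equiv.Perm (Fin 5)) =
      Equiv.swap 1 2 * Equiv.swap 0 2 * Equiv.swap 1 2 := by decide
    exact e ▸ mul_mem (mul_mem h12 h02) h12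
  rw [← Equiv.Perm.mclosure_swap_castSucc_succ 4, Submonoid.closure_le]
  rintro _ ⟨i, rfl⟩
  fin_cases i
  exacts [h01, h12, h23, h34]

end FiveLinearForm

section FiveLinearEstimate

theorem lintegral_tri_mul {A B D W : ℝ × ℝ → ℝ≥0∞} (hA : Measurable A) (hB : Measurable B)
    (hD : Measurable D) (hW : Measurable W) :
    ∫⁻ x, ∫⁻ y, ∫⁻ w, A x * (B y * (D w * W (x + y + w))) = ∫⁻ z, tri A B D z * W z := by
  have h : Measurable fun p : ((ℝ × ℝ) × (ℝ × ℝ)) × (ℝ × ℝ) =>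
      A p.1.2 * (B p.2 * D (p.1.1 - p.1.2 - p.2)) * W p.1.1 := by fun_prop
  have h' : Measurable fun p : ((ℝ × ℝ) × (ℝ × ℝ)) × (ℝ × ℝ) =>
      A p.1.2 * (B p.2 * D (p.1.1 - p.1.2 - p.2)) := by fun_prop
  have e : ∀ z, tri A B D z * W z =
      ∫⁻ x, ∫⁻ y, A x * (B y * D (z - x - y)) * W z := by
    intro z
    have hz : Measurable fun x => ∫⁻ y, A x * (B y * D (z - x - y)) :=
      h'.lintegral_prod_right'.comp (g := fun p : (ℝ × ℝ) × (ℝ × ℝ) =>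
        ∫⁻ y, A p.2 * (B y * D (p.1 - p.2 - y))) (f := fun x => (z, x)) (by fun_prop)
    rw [tri, ← lintegral_mul_const _ hz]
    refine lintegral_congr fun x => ?_
    rw [← lintegral_mul_const _ (by fun_prop)]
  simp only [e]
  rw [lintegral_lintegral_swap (f := fun z x => ∫⁻ y, A x * (B y * D (z - x - y)) * W z)
    h.lintegral_prod_right'.aemeasurable]
  refine lintegral_congr fun x => ?_
  rw [lintegral_lintegral_swap (f := fun z y => A x * (B y * D (z - x - y)) * W z)
    (Measurable.aemeasurable (by fun_prop))]
  refine lintegral_congr fun y => ?_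
  rw [← lintegral_sub_right_eq_self (fun w => A x * (B y * (D w * W (x + y + w)))) (x + y)]
  refine lintegral_congr fun z => ?_
  rw [show z - (x + y) = z - x - y by abel, show x + y + (z - x - y) = z by abel]
  ring

theorem zeroSumIntegral_eq_lintegral_tri_mul {A B D : ℝ × ℝ → ℝ≥0∞}
    {Q : (ℝ × ℝ) → (ℝ × ℝ) → ℝ≥0∞} (hA : Measurable A) (hB : Measurable B) (hD : Measurable D)
    (hQ : Measurable fun p : (ℝ × ℝ) × (ℝ × ℝ) => Q p.1 p.2) :
    zeroSumIntegral (fun x => A (x 1) * (B (x 2) * (D (x 3) * Q (x 0) (x 4)))) =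
      ∫⁻ z, tri A B D z * ∫⁻ y, Q (-z - y) y := by
  have h : Measurable fun p : (ℝ × ℝ) × (ℝ × ℝ) => Q (-p.1 - p.2) p.2 :=
    hQ.comp (f := fun p : (ℝ × ℝ) × (ℝ × ℝ) => (-p.1 - p.2, p.2)) (by fun_prop)
  rw [← lintegral_tri_mul hA hB hD h.lintegral_prod_right']
  refine lintegral_congr fun x₁ => lintegral_congr fun x₂ => lintegral_congr fun x₃ => ?_
  have h' : Measurable fun y => Q (-(x₁ + x₂ + x₃) - y) y :=
    h.comp (f := fun y => (x₁ + x₂ + x₃, y)) (by fun_prop)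
  rw [← lintegral_const_mul _ h', ← lintegral_const_mul _ (by fun_prop),
    ← lintegral_const_mul _ (by fun_prop)]
  refine lintegral_congr fun x₄ => ?_
  simp only [zeroSum]
  rw [← neg_add']
  rfl

theorem ENNReal_rpow_half_sq (a : ℝ≥0∞) : (a ^ (1 / 2 : ℝ)) ^ 2 = a := by
  rw [← ENNReal.rpow_natCast, ← ENNReal.rpow_mul]
  norm_num

theorem ENNReal_sq_rpow_half (a : ℝ≥0∞) : (a ^ 2) ^ (1 / 2 : ℝ) = a := by
  rw [← ENNReal.rpow_natCast, ← ENNReal.rpow_mul]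
  norm_num

/-- The kernel with a bilinear smoothing factor in the coordinates `0`, `4` and a half derivative
on the coordinate `1`. -/
def smoothingKernel (x : Fin 5 → ℝ × ℝ) : ℝ≥0∞ :=
  smoothSq (x 0).2 (x 4).2 ^ (1 / 2 : ℝ) * ENNReal.ofReal (1 + |(x 1).2|) ^ (1 / 2 : ℝ)

theorem measurable_smoothingKernel : Measurable smoothingKernel := by
  have h : Measurable fun x : Fin 5 → ℝ × ℝ => smoothSq (x 0).2 (x 4).2 :=
    measurable_smoothSq.comp (f := fun x : Fin 5 → ℝ × ℝ => ((x 0).2, (x 4).2)) (by fun_prop)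
  unfold smoothingKernel
  fun_prop

variable {θ : ℝ → ℝ≥0∞}

theorem lintegral_smoothing_pair_sq_le (hθ : Measurable θ) (hθ1 : ∀ t, θ t ≤ 1)
    {f g : ℝ × ℝ → ℝ≥0∞} (hf : Measurable f) (hg : Measurable g) :
    ∫⁻ z, (∫⁻ y, smoothSq (z - y).2 y.2 ^ (1 / 2 : ℝ) *
      (θ (modulation (z - y)) * f (z - y) * (θ (modulation y) * g y))) ^ 2 ≤
      (2 * (∫⁻ t, θ t ^ 2) ^ 2 + 2 * ∫⁻ t, θ t ^ 2) *
        ((∫⁻ x, f x ^ 2) * ∫⁻ x, g x ^ 2) := by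
  have hcs : ∀ z : ℝ × ℝ, (∫⁻ y, smoothSq (z - y).2 y.2 ^ (1 / 2 : ℝ) *
      (θ (modulation (z - y)) * f (z - y) * (θ (modulation y) * g y))) ^ 2 ≤
      (2 * (∫⁻ t, θ t ^ 2) ^ 2 + 2 * ∫⁻ t, θ t ^ 2) * ∫⁻ y, f (z - y) ^ 2 * g y ^ 2 := by
    intro z
    have hs : Measurable fun y : ℝ × ℝ => smoothSq (z - y).2 y.2 :=
      measurable_smoothSq.comp (f := fun y : ℝ × ℝ => ((z - y).2, y.2)) (by fun_prop)
    have h := sq_lintegral_mul_le (μ := volume)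
      (f := fun y => smoothSq (z - y).2 y.2 ^ (1 / 2 : ℝ) *
        (θ (modulation (z - y)) * θ (modulation y)))
      (g := fun y => f (z - y) * g y) (Measurable.aemeasurable (by fun_prop))
      (Measurable.aemeasurable (by fun_prop))
    have h2 := lintegral_smoothSq_le (ω := fun t => θ t ^ 2) (by fun_prop)
      (fun t => pow_le_one₀ zero_le (hθ1 t)) z
    simp only [mul_pow, ENNReal_rpow_half_sq] at h
    refine le_trans (le_of_eq ?_) (h.trans (mul_le_mul_left h2 _))
    congr 1
    refine lintegral_congr fun y => ?_
    ring
  refine (lintegral_mono hcs).trans (le_of_eq ?_)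
  have h : Measurable fun p : (ℝ × ℝ) × (ℝ × ℝ) => f (p.1 - p.2) ^ 2 * g p.2 ^ 2 := by fun_prop
  rw [lintegral_const_mul _ h.lintegral_prod_right',
    lintegral_lintegral_swap (f := fun z y => f (z - y) ^ 2 * g y ^ 2) h.aemeasurable,
    ← lintegral_const_mul (∫⁻ x, f x ^ 2) (by fun_prop)]
  congr 1
  refine lintegral_congr fun y => ?_
  rw [lintegral_mul_const _ (by fun_prop), lintegral_sub_right_eq_self (fun x => f x ^ 2)]

theorem lintegral_tri_halfDeriv_sq_le (hθ : Measurable θ) (hθ1 : ∀ t, θ t ≤ 1)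
    (hθe : ∀ t, θ (-t) = θ t) {f₁ f₂ f₃ : ℝ × ℝ → ℝ≥0∞} (h₁ : Measurable f₁)
    (h₂ : Measurable f₂) (h₃ : Measurable f₃) :
    ∫⁻ z, tri ((fun x => ENNReal.ofReal (1 + |x.2|) ^ (1 / 2 : ℝ) * θ (modulation x)) * f₁)
      ((θ ∘ modulation) * f₂) ((θ ∘ modulation) * f₃) z ^ 2 ≤
      8 * (2 * (ENNReal.ofReal (8 * Real.pi) * (∫⁻ t, θ t ^ 2) ^ 3) + 2 * (∫⁻ t, θ t ^ 2) ^ 2) *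
        ((∫⁻ x, f₁ x ^ 2) * ((∫⁻ x, f₂ x ^ 2) * ∫⁻ x, f₃ x ^ 2)) := by
  refine lintegral_tri_sq_le (by fun_prop) (by fun_prop) (by fun_prop) ?_ ?_ ?_ ?_ h₁ h₂ h₃
  · intro x
    simp [modulation_neg, hθe]
  · intro x
    simp [modulation_neg, hθe]
  · intro x
    simp [modulation_neg, hθe]
  · intro z
    have hsq : ∀ ξ, posInd ξ ^ 2 = posInd ξ := by
      intro ξ
      by_cases hξ : 0 ≤ ξ <;> simp [posInd, hξ]
    refine le_trans (le_of_eq ?_) (lintegral_trilinear_kernel_le (ω := fun t => θ t ^ 2)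
      (by fun_prop) (fun t => pow_le_one₀ zero_le (hθ1 t)) z)
    refine lintegral_congr fun x => lintegral_congr fun y => ?_
    simp only [Pi.pow_apply, posFreq, mul_pow, hsq, ENNReal_rpow_half_sq, Function.comp_apply]
    ring

theorem sq_zeroSumIntegral_smoothingKernel_le (hθ : Measurable θ) (hθ1 : ∀ t, θ t ≤ 1)
    (hθe : ∀ t, θ (-t) = θ t) {F : Fin 5 → ℝ × ℝ → ℝ≥0∞} (hF : ∀ i, Measurable (F i)) :
    zeroSumIntegral (fun x => smoothingKernel x * ∏ i, (θ (modulation (x i)) * F i (x i))) ^ 2 ≤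
      8 * (2 * (ENNReal.ofReal (8 * Real.pi) * (∫⁻ t, θ t ^ 2) ^ 3) + 2 * (∫⁻ t, θ t ^ 2) ^ 2) *
        (2 * (∫⁻ t, θ t ^ 2) ^ 2 + 2 * ∫⁻ t, θ t ^ 2) * ∏ i, ∫⁻ x, F i x ^ 2 := by
  have hs := measurable_smoothSq
  have hF0 := hF 0
  have hF1 := hF 1
  have hF2 := hF 2
  have hF3 := hF 3
  have hF4 := hF 4
  set A : ℝ × ℝ → ℝ≥0∞ :=
    (fun x => ENNReal.ofReal (1 + |x.2|) ^ (1 / 2 : ℝ) * θ (modulation x)) * F 1 with hA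
  set B : ℝ × ℝ → ℝ≥0∞ := (θ ∘ modulation) * F 2 with hB
  set D : ℝ × ℝ → ℝ≥0∞ := (θ ∘ modulation) * F 3 with hD
  set Q : ℝ × ℝ → ℝ × ℝ → ℝ≥0∞ := fun x y => smoothSq x.2 y.2 ^ (1 / 2 : ℝ) *
    (θ (modulation x) * F 0 x * (θ (modulation y) * F 4 y)) with hQ
  have hAm : Measurable A := by rw [hA]; fun_prop
  have hBm : Measurable B := by rw [hB]; fun_prop
  have hDm : Measurable D := by rw [hD]; fun_prop
  have hs' : Measurable fun p : (ℝ × ℝ) × (ℝ × ℝ) => smoothSq p.1.2 p.2.2 :=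
    hs.comp (f := fun p : (ℝ × ℝ) × (ℝ × ℝ) => (p.1.2, p.2.2)) (by fun_prop)
  have hQm : Measurable fun p : (ℝ × ℝ) × (ℝ × ℝ) => Q p.1 p.2 := by rw [hQ]; fun_prop
  have e : (fun x : Fin 5 → ℝ × ℝ => smoothingKernel x * ∏ i, (θ (modulation (x i)) * F i (x i))) =
      fun x => A (x 1) * (B (x 2) * (D (x 3) * Q (x 0) (x 4))) := by
    ext x
    simp only [smoothingKernel, Fin.prod_univ_five, hA, hB, hD, hQ, Pi.mul_apply,
      Function.comp_apply]
    ring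
  have hWm : Measurable fun z => ∫⁻ y, Q (-z - y) y :=
    (hQm.comp (f := fun p : (ℝ × ℝ) × (ℝ × ℝ) => (-p.1 - p.2, p.2))
      (by fun_prop)).lintegral_prod_right'
  rw [e, zeroSumIntegral_eq_lintegral_tri_mul hAm hBm hDm hQm]
  refine (sq_lintegral_mul_le (measurable_tri hAm hBm hDm).aemeasurable
    hWm.aemeasurable).trans ?_
  have h1 := lintegral_tri_halfDeriv_sq_le hθ hθ1 hθe (hF 1) (hF 2) (hF 3)
  have h2 := lintegral_smoothing_pair_sq_le hθ hθ1 (hF 0) (hF 4)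
  rw [← lintegral_neg_eq_self] at h2
  refine (mul_le_mul' h1 h2).trans (le_of_eq ?_)
  rw [Fin.prod_univ_five]
  ring

end FiveLinearEstimate

section FrequencyOrdering

theorem exists_perm_antitone_abs (ξ : Fin 5 → ℝ) :
    ∃ σ : Equiv.Perm (Fin 5), Antitone fun j => |ξ (σ j)| := by
  refine ⟨Tuple.sort fun j => -|ξ j|, fun i j hij => ?_⟩
  have h := Tuple.monotone_sort (fun j => -|ξ j|) hij
  simpa using h

theorem abs_le_four_mul_of_sum_eq_zero {a b c d e : ℝ} (h : a + b + c + d + e = 0)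
    (hcb : |c| ≤ |b|) (hdb : |d| ≤ |b|) (heb : |e| ≤ |b|) : |a| ≤ 4 * |b| := by
  have e1 : a = -(b + c + d + e) := by linarith
  rw [e1, abs_neg]
  have := abs_add_le (b + c + d) e
  have := abs_add_le (b + c) d
  have := abs_add_le b c
  linarith

/-- Five real numbers of comparable size cannot sum to zero. -/
theorem sq_le_two_mul_sq_sub_sq_of_sum_eq_zero {a b c d e : ℝ} (h : a + b + c + d + e = 0)
    (hba : |b| ≤ |a|) (hcb : |c| ≤ |b|) (hdc : |d| ≤ |c|) (hed : |e| ≤ |d|) :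
    a ^ 2 ≤ 2 * (a ^ 2 - e ^ 2) := by
  by_contra! hcon
  have ha0 : 0 < |a| := by
    by_contra! h0
    have h1 : |a| = 0 := le_antisymm h0 (abs_nonneg a)
    have h2 : a = 0 := abs_eq_zero.1 h1
    have h3 : e = 0 := abs_eq_zero.1 (le_antisymm (by linarith) (abs_nonneg e))
    simp [h2, h3] at hcon
  have he : 7 * |a| < 10 * |e| := by
    refine lt_of_pow_lt_pow_left₀ 2 (by positivity) ?_
    rw [mul_pow, mul_pow, sq_abs, sq_abs]
    nlinarith [sq_nonneg a]
  rcases abs_cases a with ⟨h1, _⟩ | ⟨h1, _⟩ <;> rcases abs_cases b with ⟨h2, _⟩ | ⟨h2, _⟩ <;>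
  rcases abs_cases c with ⟨h3, _⟩ | ⟨h3, _⟩ <;> rcases abs_cases d with ⟨h4, _⟩ | ⟨h4, _⟩ <;>
  rcases abs_cases e with ⟨h5, _⟩ | ⟨h5, _⟩ <;> linarith

theorem exists_perm_pow_three_le_smoothingKernel_sq {x : Fin 5 → ℝ × ℝ} (hx : ∑ i, x i = 0) :
    ∃ σ : Equiv.Perm (Fin 5), (∀ j, |(x j).2| ≤ |(x (σ 0)).2|) ∧
      ENNReal.ofReal ((1 + |(x (σ 0)).2|) ^ 3) ≤ 64 * smoothingKernel (x ∘ σ) ^ 2 := by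
  obtain ⟨σ, hσ⟩ := exists_perm_antitone_abs fun j => (x j).2
  have hmax : ∀ j, |(x j).2| ≤ |(x (σ 0)).2| := by
    intro j
    have h := hσ (Fin.zero_le (σ.symm j))
    simpa using h
  refine ⟨σ, hmax, ?_⟩
  have hsum : (x (σ 0)).2 + (x (σ 1)).2 + (x (σ 2)).2 + (x (σ 3)).2 + (x (σ 4)).2 = 0 := by
    have h := congrArg Prod.snd hx
    rw [Prod.snd_sum, ← Equiv.sum_comp σ, Fin.sum_univ_five] at h
    exact h
  have h10 := hσ (show (0 : Fin 5) ≤ 1 by decide)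
  have h21 := hσ (show (1 : Fin 5) ≤ 2 by decide)
  have h32 := hσ (show (2 : Fin 5) ≤ 3 by decide)
  have h43 := hσ (show (3 : Fin 5) ≤ 4 by decide)
  simp only at h10 h21 h32 h43
  simp only [smoothingKernel, Function.comp_apply, mul_pow, ENNReal_rpow_half_sq]
  generalize (x (σ 0)).2 = a at *
  generalize (x (σ 1)).2 = b at *
  generalize (x (σ 2)).2 = c at *
  generalize (x (σ 3)).2 = d at *
  generalize (x (σ 4)).2 = e at *
  have e64 : (64 : ℝ≥0∞) = ENNReal.ofReal 64 := by norm_num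
  rcases le_or_gt |a| 1 with ha | ha
  · have hs : 1 ≤ smoothSq a e := by
      have : e ∈ Icc (-1 : ℝ) 1 := abs_le.1 (by linarith)
      simp [smoothSq, this]
    calc ENNReal.ofReal ((1 + |a|) ^ 3) ≤ ENNReal.ofReal (64 * (1 + |b|)) := by
          refine ENNReal.ofReal_le_ofReal ?_
          have h1 : (1 + |a|) ^ 3 ≤ 2 ^ 3 := by gcongr; linarith
          linarith [abs_nonneg b]
      _ = 64 * (1 * ENNReal.ofReal (1 + |b|)) := by
          rw [one_mul, e64, ENNReal.ofReal_mul (by norm_num)]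
      _ ≤ _ := by gcongr
  · have h1 := abs_le_four_mul_of_sum_eq_zero hsum (by linarith) (by linarith) (by linarith)
    have h2 := sq_le_two_mul_sq_sub_sq_of_sum_eq_zero hsum h10 h21 h32 h43
    calc ENNReal.ofReal ((1 + |a|) ^ 3) ≤ ENNReal.ofReal (64 * (|a ^ 2 - e ^ 2| * (1 + |b|))) := by
          refine ENNReal.ofReal_le_ofReal ?_
          have h3 := le_abs_self (a ^ 2 - e ^ 2)
          have h4 : |a| ^ 2 ≤ 2 * |a ^ 2 - e ^ 2| := by rw [sq_abs]; linarith
          have h5 : (1 + |a|) ^ 2 ≤ 8 * |a ^ 2 - e ^ 2| := by nlinarith [abs_nonneg a]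
          calc (1 + |a|) ^ 3 = (1 + |a|) ^ 2 * (1 + |a|) := by ring
            _ ≤ (8 * |a ^ 2 - e ^ 2|) * (8 * (1 + |b|)) := by
              gcongr
              linarith [abs_nonneg b]
            _ = _ := by ring
      _ = 64 * (ENNReal.ofReal |a ^ 2 - e ^ 2| * ENNReal.ofReal (1 + |b|)) := by
          rw [e64, ENNReal.ofReal_mul (by norm_num), ENNReal.ofReal_mul (abs_nonneg _)]
      _ ≤ _ := by
          gcongr
          exact le_self_add

end FrequencyOrdering

section SymmetrizedEstimate

variable {θ : ℝ → ℝ≥0∞} {m : (Fin 5 → ℝ × ℝ) → ℝ≥0∞}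

theorem exists_perm_le_smoothingKernel
    (hm : ∀ x i, (∀ j, |(x j).2| ≤ |(x i).2|) →
      m x ^ 2 ≤ ENNReal.ofReal ((1 + |(x i).2|) ^ 3))
    {x : Fin 5 → ℝ × ℝ} (hx : ∑ i, x i = 0) :
    ∃ σ : Equiv.Perm (Fin 5), m x ≤ 8 * smoothingKernel (x ∘ σ) := by
  obtain ⟨σ, h1, h2⟩ := exists_perm_pow_three_le_smoothingKernel_sq hx
  refine ⟨σ, (ENNReal.pow_le_pow_left_iff two_ne_zero).1 ?_⟩
  refine ((hm x _ h1).trans h2).trans (le_of_eq ?_)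
  rw [mul_pow]
  norm_num

theorem sq_zeroSumIntegral_multiplier_le (hθ : Measurable θ) (hθ1 : ∀ t, θ t ≤ 1)
    (hθe : ∀ t, θ (-t) = θ t) (hθ2 : ∫⁻ t, θ t ^ 2 ≠ ⊤)
    (hm : ∀ x i, (∀ j, |(x j).2| ≤ |(x i).2|) →
      m x ^ 2 ≤ ENNReal.ofReal ((1 + |(x i).2|) ^ 3)) :
    ∃ C : ℝ≥0∞, C ≠ ⊤ ∧ ∀ F : Fin 5 → ℝ × ℝ → ℝ≥0∞, (∀ i, Measurable (F i)) →
      zeroSumIntegral (fun x => m x * ∏ i, (θ (modulation (x i)) * F i (x i))) ^ 2 ≤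
        C * ∏ i, ∫⁻ x, F i x ^ 2 := by
  set C₀ : ℝ≥0∞ :=
    8 * (2 * (ENNReal.ofReal (8 * Real.pi) * (∫⁻ t, θ t ^ 2) ^ 3) + 2 * (∫⁻ t, θ t ^ 2) ^ 2) *
      (2 * (∫⁻ t, θ t ^ 2) ^ 2 + 2 * ∫⁻ t, θ t ^ 2) with hC₀
  have hC₀t : C₀ ≠ ⊤ := by
    rw [hC₀]
    finiteness
  refine ⟨960 ^ 2 * C₀, by finiteness, fun F hF => ?_⟩
  set E : ℝ≥0∞ := ∏ i, ∫⁻ x, F i x ^ 2 with hE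
  set G : Equiv.Perm (Fin 5) → (Fin 5 → ℝ × ℝ) → ℝ≥0∞ := fun σ x =>
    smoothingKernel x * ∏ i, (θ (modulation (x i)) * F (σ i) (x i)) with hG
  have hGm : ∀ σ, Measurable (G σ) := by
    intro σ
    have h := measurable_smoothingKernel
    have h' : ∀ i, Measurable fun x : Fin 5 → ℝ × ℝ => F (σ i) (x i) :=
      fun i => (hF _).comp (measurable_pi_apply i)
    refine h.mul (Finset.measurable_prod _ fun i _ => Measurable.mul (by fun_prop) (h' i))
  have hGσ : ∀ σ, zeroSumIntegral (G σ) ≤ (C₀ * E) ^ (1 / 2 : ℝ) := by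
    intro σ
    have h := sq_zeroSumIntegral_smoothingKernel_le hθ hθ1 hθe (F := fun i => F (σ i))
      (fun i => hF _)
    rw [Equiv.prod_comp σ fun i => ∫⁻ x, F i x ^ 2] at h
    rw [← ENNReal_sq_rpow_half (zeroSumIntegral (G σ))]
    exact ENNReal.rpow_le_rpow h (by norm_num)
  have hle : zeroSumIntegral (fun x => m x * ∏ i, (θ (modulation (x i)) * F i (x i))) ≤
      zeroSumIntegral (fun x => 8 * ∑ σ, G σ (x ∘ σ)) := by
    refine zeroSumIntegral_mono fun x hx => ?_
    obtain ⟨σ, hσ⟩ := exists_perm_le_smoothingKernel hm hx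
    calc m x * ∏ i, (θ (modulation (x i)) * F i (x i))
        ≤ 8 * smoothingKernel (x ∘ σ) * ∏ i, (θ (modulation (x i)) * F i (x i)) :=
          mul_le_mul_left hσ _
      _ = 8 * G σ (x ∘ σ) := by
          rw [← Equiv.prod_comp σ, mul_assoc]
          rfl
      _ ≤ 8 * ∑ σ, G σ (x ∘ σ) :=
          mul_le_mul_right (Finset.single_le_sum (f := fun σ => G σ (x ∘ σ))
            (fun _ _ => zero_le) (Finset.mem_univ σ)) _
  have hGc : ∀ σ : Equiv.Perm (Fin 5), Measurable fun x : Fin 5 → ℝ × ℝ => G σ (x ∘ σ) :=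
    fun σ => (hGm σ).comp (by fun_prop)
  have hsum : zeroSumIntegral (fun x => 8 * ∑ σ, G σ (x ∘ σ)) ≤
      960 * (C₀ * E) ^ (1 / 2 : ℝ) := by
    rw [zeroSumIntegral_const_mul (Finset.measurable_sum _ fun σ _ => hGc σ),
      zeroSumIntegral_sum _ hGc]
    calc 8 * ∑ σ, zeroSumIntegral (fun x => G σ (x ∘ σ))
        ≤ 8 * ∑ _σ : Equiv.Perm (Fin 5), (C₀ * E) ^ (1 / 2 : ℝ) := by
          refine mul_le_mul_right (Finset.sum_le_sum fun σ _ => ?_) _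
          rw [zeroSumIntegral_comp_perm (hGm σ)]
          exact hGσ σ
      _ = 960 * (C₀ * E) ^ (1 / 2 : ℝ) := by
          rw [Finset.sum_const, Finset.card_univ, Fintype.card_perm, Fintype.card_fin,
            nsmul_eq_mul, ← mul_assoc]
          norm_num [Nat.factorial]
  calc _ ≤ (960 * (C₀ * E) ^ (1 / 2 : ℝ)) ^ 2 := pow_le_pow_left₀ zero_le (hle.trans hsum) 2
    _ = 960 ^ 2 * C₀ * E := by
        rw [mul_pow, ENNReal_rpow_half_sq]
        exact (mul_assoc _ _ _).symm

end SymmetrizedEstimate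

section Weights

/-- The modulation weight `⟨t⟩^{-b}`. -/
def modWeight (b t : ℝ) : ℝ≥0∞ := ENNReal.ofReal (jap (-b) t)

theorem jap_pos (s t : ℝ) : 0 < jap s t := by
  unfold jap
  positivity

theorem continuous_jap (s : ℝ) : Continuous (jap s) := by
  unfold jap
  exact Continuous.rpow_const (by fun_prop) fun x => Or.inl (by positivity)

theorem jap_neg_mul_jap (s t : ℝ) : jap (-s) t * jap s t = 1 := by
  unfold jap
  rw [← Real.rpow_add (by positivity), neg_div, neg_add_cancel, Real.rpow_zero]

theorem measurable_modWeight (b : ℝ) : Measurable (modWeight b) :=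
  ENNReal.measurable_ofReal.comp (continuous_jap _).measurable

theorem modWeight_neg (b t : ℝ) : modWeight b (-t) = modWeight b t := by
  simp [modWeight, jap]

theorem modWeight_le_one {b : ℝ} (hb : 0 ≤ b) (t : ℝ) : modWeight b t ≤ 1 := by
  rw [modWeight, ENNReal.ofReal_le_one, jap]
  exact Real.rpow_le_one_of_one_le_of_nonpos (by linarith [sq_nonneg t]) (by linarith)

theorem lintegral_modWeight_sq_ne_top {b : ℝ} (hb : 1 / 2 < b) :
    ∫⁻ t, modWeight b t ^ 2 ≠ ⊤ := by
  have h := integrable_rpow_neg_one_add_norm_sq (E := ℝ) (μ := volume) (r := 2 * b)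
    (by simp; linarith)
  have e : ∀ t : ℝ, modWeight b t ^ 2 = ENNReal.ofReal ((1 + ‖t‖ ^ 2) ^ (-(2 * b) / 2)) := by
    intro t
    rw [modWeight, ← ENNReal.ofReal_pow (jap_pos _ _).le, jap, ← Real.rpow_natCast,
      ← Real.rpow_mul (by positivity), Real.norm_eq_abs, sq_abs]
    congr 2
    push_cast
    ring
  simp only [e]
  exact h.lintegral_lt_top.ne

theorem jap_le_rpow {s N ξ : ℝ} (hs : 0 ≤ s) (h : |ξ| ≤ N) : jap s ξ ≤ (1 + N) ^ s := by
  have h0 : 0 ≤ N := (abs_nonneg ξ).trans h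
  have h1 : 1 + ξ ^ 2 ≤ (1 + N) ^ 2 := by nlinarith [sq_abs ξ, abs_nonneg ξ]
  calc jap s ξ ≤ ((1 + N) ^ 2) ^ (s / 2) := Real.rpow_le_rpow (by positivity) h1 (by linarith)
    _ = (1 + N) ^ s := by
      rw [← Real.rpow_natCast, ← Real.rpow_mul (by positivity)]
      congr 1
      push_cast
      ring

/-- The multiplier of the derivative and the negative-order Sobolev weights. -/
def quadMultiplier (s : Fin 4 → ℝ) (x : Fin 5 → ℝ × ℝ) : ℝ≥0∞ :=
  ENNReal.ofReal (|(x 0).2| * ∏ j, jap (-s j) (x j.succ).2)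

theorem quadMultiplier_sq_le {s : Fin 4 → ℝ} (hs : ∀ j, s j ≤ 0) (hsum : ∑ j, s j = -(1 / 2))
    (x : Fin 5 → ℝ × ℝ) (i : Fin 5) (h : ∀ j, |(x j).2| ≤ |(x i).2|) :
    quadMultiplier s x ^ 2 ≤ ENNReal.ofReal ((1 + |(x i).2|) ^ 3) := by
  have hprod : 0 ≤ ∏ j, jap (-s j) (x j.succ).2 := Finset.prod_nonneg fun j _ => (jap_pos _ _).le
  rw [quadMultiplier, ← ENNReal.ofReal_pow (by positivity)]
  refine ENNReal.ofReal_le_ofReal ?_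
  set N := |(x i).2| with hN
  have hN0 : 0 ≤ N := abs_nonneg _
  have h1 : ∏ j, jap (-s j) (x j.succ).2 ≤ (1 + N) ^ (1 / 2 : ℝ) := by
    calc ∏ j, jap (-s j) (x j.succ).2 ≤ ∏ j, (1 + N) ^ (-s j) :=
          Finset.prod_le_prod (fun j _ => (jap_pos _ _).le)
            fun j _ => jap_le_rpow (by linarith [hs j]) (h _)
      _ = (1 + N) ^ (1 / 2 : ℝ) := by
          rw [← Real.rpow_sum_of_pos (by positivity), Finset.sum_neg_distrib, hsum, neg_neg]
  have h2 : (∏ j, jap (-s j) (x j.succ).2) ^ 2 ≤ 1 + N := by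
    calc _ ≤ ((1 + N) ^ (1 / 2 : ℝ)) ^ 2 := by gcongr
      _ = 1 + N := by
        rw [← Real.rpow_natCast, ← Real.rpow_mul (by positivity)]
        norm_num
  calc (|(x 0).2| * ∏ j, jap (-s j) (x j.succ).2) ^ 2
      = |(x 0).2| ^ 2 * (∏ j, jap (-s j) (x j.succ).2) ^ 2 := by ring
    _ ≤ (1 + N) ^ 2 * (1 + N) := by
        gcongr
        linarith [h 0]
    _ = (1 + N) ^ 3 := by ring

end Weights

section PlaneFourier

open scoped SchwartzMap FourierTransform LineDeriv

/-- The identification of the Euclidean plane with the product `ℝ × ℝ`. -/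
def planeEquiv : WithLp 2 (ℝ × ℝ) ≃L[ℝ] ℝ × ℝ := WithLp.prodContinuousLinearEquiv 2 ℝ ℝ ℝ

theorem two_pi_inv_ne_zero : (-(2 * Real.pi)⁻¹ : ℝ) ≠ 0 := by
  have := Real.pi_pos
  simp [this.ne']

/-- The change of frequency variables between the two normalizations of the Fourier transform. -/
def freqEquiv : (ℝ × ℝ) ≃L[ℝ] WithLp 2 (ℝ × ℝ) :=
  (ContinuousLinearEquiv.smulLeft (M₁ := ℝ × ℝ) (R₁ := ℝ)
    (Units.mk0 (-(2 * Real.pi)⁻¹ : ℝ) two_pi_inv_ne_zero)).trans planeEquiv.symm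

theorem freqEquiv_apply (x : ℝ × ℝ) :
    freqEquiv x = WithLp.toLp 2 ((-(2 * Real.pi)⁻¹ : ℝ) • x) := rfl

theorem two_pi_mul_inner_freqEquiv (p x : ℝ × ℝ) :
    (((-(2 * Real.pi) * inner ℝ (WithLp.toLp 2 p) (freqEquiv x) : ℝ)) : ℂ) =
      p.1 * x.1 + p.2 * x.2 := by
  have := Real.pi_ne_zero
  rw [freqEquiv_apply, WithLp.prod_inner_apply]
  simp only [RCLike.inner_apply, conj_trivial, Prod.smul_fst, Prod.smul_snd, smul_eq_mul]
  norm_cast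
  field_simp
  ring

/-- The space-time Fourier transform as an operator on Schwartz functions. -/
def planeFourier (φ : 𝓢(ℝ × ℝ, ℂ)) : 𝓢(ℝ × ℝ, ℂ) :=
  SchwartzMap.compCLMOfContinuousLinearEquiv ℂ freqEquiv
    (𝓕 (SchwartzMap.compCLMOfContinuousLinearEquiv ℂ planeEquiv φ))

theorem planeFourier_apply (φ : 𝓢(ℝ × ℝ, ℂ)) (x : ℝ × ℝ) :
    planeFourier φ x =
      ∫ p : ℝ × ℝ, Complex.exp (Complex.I * (p.1 * x.1 + p.2 * x.2)) * φ p := by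
  simp only [planeFourier, SchwartzMap.compCLMOfContinuousLinearEquiv_apply, Function.comp_apply,
    SchwartzMap.fourier_coe]
  rw [Real.fourier_eq', ← (WithLp.volume_preserving_ofLp ℝ ℝ).integral_comp
    (MeasurableEquiv.toLp 2 (ℝ × ℝ)).symm.measurableEmbedding]
  refine integral_congr_ae (.of_forall fun v => ?_)
  simp only [smul_eq_mul]
  congr 2
  rw [← two_pi_mul_inner_freqEquiv]
  simp only [WithLp.toLp_ofLp]
  push_cast
  ring

theorem FT2_eq_planeFourier (φ : 𝓢(ℝ × ℝ, ℂ)) (x : ℝ × ℝ) :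
    FT2 (fun t y => φ (t, y)) x.1 x.2 = planeFourier φ x := by
  rw [planeFourier_apply]
  rfl

theorem exists_planeFourier_inversion : ∃ c : ℝ, ∀ (φ : 𝓢(ℝ × ℝ, ℂ)) (p : ℝ × ℝ),
    φ p = c * ∫ x : ℝ × ℝ, Complex.exp (-(Complex.I * (p.1 * x.1 + p.2 * x.2))) *
      planeFourier φ x := by
  refine ⟨|(-(2 * Real.pi)⁻¹) ^ 2|, fun φ p => ?_⟩
  set g := SchwartzMap.compCLMOfContinuousLinearEquiv ℂ planeEquiv φ
  have h₁ : φ p = (𝓕⁻ (𝓕 g)) (WithLp.toLp 2 p) := by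
    rw [FourierTransform.fourierInv_fourier_eq]
    rfl
  rw [h₁, SchwartzMap.fourierInv_coe, Real.fourierInv_eq',
    ← (WithLp.volume_preserving_toLp ℝ ℝ).integral_comp
      (MeasurableEquiv.toLp 2 (ℝ × ℝ)).measurableEmbedding]
  have h₂ := Measure.integral_comp_smul (volume : Measure (ℝ × ℝ)) (fun w : ℝ × ℝ =>
    Complex.exp (((2 * Real.pi * inner ℝ (WithLp.toLp 2 w) (WithLp.toLp 2 p) : ℝ) : ℂ) *
      Complex.I) • (𝓕 g) (WithLp.toLp 2 w)) (-(2 * Real.pi)⁻¹)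
  have h₃ : Module.finrank ℝ (ℝ × ℝ) = 2 := by simp
  have h₄ : |((-(2 * Real.pi)⁻¹ : ℝ) ^ 2)| ≠ 0 := by
    simp [Real.pi_ne_zero]
  rw [h₃, abs_inv, eq_comm, inv_smul_eq_iff₀ h₄] at h₂
  rw [h₂, Complex.real_smul]
  congr 1
  refine integral_congr_ae (.of_forall fun x => ?_)
  change _ * planeFourier φ x = _
  congr 2
  rw [← two_pi_mul_inner_freqEquiv, ← freqEquiv_apply, real_inner_comm]
  push_cast
  ring

theorem planeFourier_lineDeriv (φ : 𝓢(ℝ × ℝ, ℂ)) (x : ℝ × ℝ) :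
    ‖planeFourier (∂_{((0 : ℝ), (1 : ℝ))} φ) x‖ₑ =
      ENNReal.ofReal |x.2| * ‖planeFourier φ x‖ₑ := by
  have h₁ : SchwartzMap.compCLMOfContinuousLinearEquiv ℂ planeEquiv (∂_{((0 : ℝ), (1 : ℝ))} φ) =
      ∂_{WithLp.toLp 2 ((0 : ℝ), (1 : ℝ))}
        (SchwartzMap.compCLMOfContinuousLinearEquiv ℂ planeEquiv φ) := by
    rw [SchwartzMap.lineDerivOp_compCLMOfContinuousLinearEquiv]
    rfl
  have h₂ : (fun v : WithLp 2 (ℝ × ℝ) =>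
      inner ℝ v (WithLp.toLp 2 ((0 : ℝ), (1 : ℝ)))).HasTemperateGrowth :=
    ((innerSL ℝ).flip (WithLp.toLp 2 ((0 : ℝ), (1 : ℝ)))).hasTemperateGrowth
  simp only [planeFourier, SchwartzMap.compCLMOfContinuousLinearEquiv_apply, Function.comp_apply]
  rw [h₁, SchwartzMap.fourier_lineDerivOp_eq, _root_.smul_apply,
    SchwartzMap.smulLeftCLM_apply_apply h₂, freqEquiv_apply, WithLp.prod_inner_apply,
    enorm_smul, enorm_smul, ← mul_assoc]
  congr 1
  rw [← ofReal_norm, ← ofReal_norm, ← ENNReal.ofReal_mul (norm_nonneg _)]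
  congr 1
  have := Real.pi_pos
  simp [abs_of_pos this]
  field_simp

/-- The pointwise product of two Schwartz functions. -/
def schwartzMul (φ ψ : 𝓢(ℝ × ℝ, ℂ)) : 𝓢(ℝ × ℝ, ℂ) :=
  SchwartzMap.pairing (ContinuousLinearMap.mul ℂ ℂ) φ ψ

theorem schwartzMul_apply (φ ψ : 𝓢(ℝ × ℝ, ℂ)) (p : ℝ × ℝ) :
    schwartzMul φ ψ p = φ p * ψ p := rfl

theorem exists_enorm_planeFourier_mul_le : ∃ c : ℝ≥0∞, c ≠ ⊤ ∧
    ∀ (φ ψ : 𝓢(ℝ × ℝ, ℂ)) (x : ℝ × ℝ), ‖planeFourier (schwartzMul φ ψ) x‖ₑ ≤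
      c * ∫⁻ η, ‖planeFourier φ η‖ₑ * ‖planeFourier ψ (x - η)‖ₑ := by
  obtain ⟨c, hc⟩ := exists_planeFourier_inversion
  refine ⟨‖(c : ℂ)‖ₑ, by finiteness, fun φ ψ x => ?_⟩
  let k : ℝ × ℝ → ℝ × ℝ → ℂ := fun p η =>
    Complex.exp (Complex.I * (p.1 * (x - η).1 + p.2 * (x - η).2)) * (planeFourier φ η * ψ p)
  have hk : Integrable (Function.uncurry k) (volume.prod volume) := by
    refine ((planeFourier φ).integrable.mul_prod ψ.integrable).swap.norm.mono' ?_ ?_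
    · have h₁ := (planeFourier φ).continuous
      have h₂ := ψ.continuous
      refine Continuous.aestronglyMeasurable ?_
      simp only [k, Function.uncurry_def]
      fun_prop
    · refine .of_forall fun z => ?_
      simp only [k, Function.uncurry_def, norm_mul, Function.comp_apply, Prod.fst_swap,
        Prod.snd_swap]
      rw [Complex.norm_exp]
      simp
  have h₁ : planeFourier (schwartzMul φ ψ) x =
      c * ∫ η, planeFourier φ η * planeFourier ψ (x - η) := by
    calc planeFourier (schwartzMul φ ψ) x = ∫ p, ↑c * ∫ η, k p η := by
          rw [planeFourier_apply]
          refine integral_congr_ae (.of_forall fun p => ?_)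
          simp only [schwartzMul_apply]
          rw [hc φ p, mul_assoc, mul_left_comm, ← integral_mul_const, ← integral_const_mul]
          congr 1
          refine integral_congr_ae (.of_forall fun η => ?_)
          simp only [k, Prod.fst_sub, Prod.snd_sub]
          have h₂ : Complex.I * (p.1 * ((x.1 - η.1 : ℝ) : ℂ) + p.2 * ((x.2 - η.2 : ℝ) : ℂ)) =
              Complex.I * (p.1 * x.1 + p.2 * x.2) + -(Complex.I * (p.1 * η.1 + p.2 * η.2)) := by
            push_cast
            ring
          rw [h₂, Complex.exp_add]
          ring
      _ = c * ∫ η, ∫ p, k p η := by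
          rw [integral_const_mul, integral_integral_swap hk]
      _ = _ := by
          congr 1
          refine integral_congr_ae (.of_forall fun η => ?_)
          simp only [k]
          rw [planeFourier_apply ψ, ← integral_const_mul]
          refine integral_congr_ae (.of_forall fun p => ?_)
          simp only
          ring
  rw [h₁, enorm_mul]
  gcongr
  refine (enorm_integral_le_lintegral_enorm _).trans_eq ?_
  simp only [enorm_mul]

end PlaneFourier

section Assembly

open scoped SchwartzMap LineDeriv

theorem exists_lintegral_mul_enorm_planeFourier_mul_le : ∃ c : ℝ≥0∞, c ≠ ⊤ ∧
    ∀ (φ ψ : 𝓢(ℝ × ℝ, ℂ)) (H : ℝ × ℝ → ℝ≥0∞), Measurable H →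
      ∫⁻ x, H x * ‖planeFourier (schwartzMul φ ψ) x‖ₑ ≤
        c * ∫⁻ y, ‖planeFourier φ y‖ₑ * ∫⁻ x, H (x + y) * ‖planeFourier ψ x‖ₑ := by
  obtain ⟨c, hc, h⟩ := exists_enorm_planeFourier_mul_le
  refine ⟨c, hc, fun φ ψ H hH => ?_⟩
  have hφ : Measurable fun x => ‖planeFourier φ x‖ₑ := (planeFourier φ).continuous.enorm.measurable
  have hψ : Measurable fun x => ‖planeFourier ψ x‖ₑ := (planeFourier ψ).continuous.enorm.measurable
  calc ∫⁻ x, H x * ‖planeFourier (schwartzMul φ ψ) x‖ₑ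
      ≤ ∫⁻ x, c * ∫⁻ y, H x * (‖planeFourier φ y‖ₑ * ‖planeFourier ψ (x - y)‖ₑ) := by
        refine lintegral_mono fun x => ?_
        rw [lintegral_const_mul _ (by fun_prop), mul_left_comm]
        exact mul_le_mul_right (h φ ψ x) _
    _ = c * ∫⁻ y, ∫⁻ x, H x * (‖planeFourier φ y‖ₑ * ‖planeFourier ψ (x - y)‖ₑ) := by
        rw [lintegral_const_mul' _ _ hc, lintegral_lintegral_swap (f := fun x y =>
          H x * (‖planeFourier φ y‖ₑ * ‖planeFourier ψ (x - y)‖ₑ))]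
        refine Measurable.aemeasurable ?_
        simp only [Function.uncurry_def]
        fun_prop
    _ = _ := by
        congr 1
        refine lintegral_congr fun y => ?_
        rw [← lintegral_const_mul _ (by fun_prop), ← lintegral_add_right_eq_self _ y]
        simp only [add_sub_cancel_right]
        exact lintegral_congr fun x => mul_left_comm _ _ _

/-- The pointwise product of four Schwartz functions. -/
def schwartzProd (u : Fin 4 → 𝓢(ℝ × ℝ, ℂ)) : 𝓢(ℝ × ℝ, ℂ) :=
  schwartzMul (u 0) (schwartzMul (u 1) (schwartzMul (u 2) (u 3)))

theorem exists_lintegral_mul_enorm_planeFourier_schwartzProd_le : ∃ c : ℝ≥0∞, c ≠ ⊤ ∧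
    ∀ (u : Fin 4 → 𝓢(ℝ × ℝ, ℂ)) (H : ℝ × ℝ → ℝ≥0∞), Measurable H →
      ∫⁻ x, H x * ‖planeFourier (schwartzProd u) x‖ₑ ≤
        c * zeroSumIntegral fun x => H (-(x 0)) * ∏ j, ‖planeFourier (u j) (x (Fin.succ j))‖ₑ := by
  obtain ⟨c, hc, h⟩ := exists_lintegral_mul_enorm_planeFourier_mul_le
  refine ⟨c ^ 3, by finiteness, fun u H hH => ?_⟩
  let g : Fin 4 → ℝ × ℝ → ℝ≥0∞ := fun j x => ‖planeFourier (u j) x‖ₑ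
  calc ∫⁻ x, H x * ‖planeFourier (schwartzProd u) x‖ₑ
      ≤ c * ∫⁻ x₁, g 0 x₁ * ∫⁻ x, H (x + x₁) *
          ‖planeFourier (schwartzMul (u 1) (schwartzMul (u 2) (u 3))) x‖ₑ := h _ _ H hH
    _ ≤ c * ∫⁻ x₁, g 0 x₁ * (c * ∫⁻ x₂, g 1 x₂ * ∫⁻ x, H (x + x₂ + x₁) *
          ‖planeFourier (schwartzMul (u 2) (u 3)) x‖ₑ) := by
        refine mul_le_mul_right (lintegral_mono fun x₁ => mul_le_mul_right ?_ _) _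
        exact h _ _ (fun x => H (x + x₁)) (by fun_prop)
    _ ≤ c * ∫⁻ x₁, g 0 x₁ * (c * ∫⁻ x₂, g 1 x₂ * (c * ∫⁻ x₃, g 2 x₃ * ∫⁻ x₄,
          H (x₄ + x₃ + x₂ + x₁) * g 3 x₄)) := by
        refine mul_le_mul_right (lintegral_mono fun x₁ => mul_le_mul_right
          (mul_le_mul_right (lintegral_mono fun x₂ => mul_le_mul_right ?_ _) _) _) _
        exact h _ _ (fun x => H (x + x₂ + x₁)) (by fun_prop)
    _ = c ^ 3 * ∫⁻ x₁, g 0 x₁ * ∫⁻ x₂, g 1 x₂ * ∫⁻ x₃, g 2 x₃ * ∫⁻ x₄,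
          H (x₄ + x₃ + x₂ + x₁) * g 3 x₄ := by
        simp only [mul_left_comm _ c, lintegral_const_mul' _ _ hc]
        ring
    _ ≤ _ := by
        refine mul_le_mul_right (lintegral_mono fun x₁ => ?_) _
        refine (lintegral_const_mul_le _ _).trans (lintegral_mono fun x₂ => ?_)
        rw [← mul_assoc]
        refine (lintegral_const_mul_le _ _).trans (lintegral_mono fun x₃ => ?_)
        rw [← mul_assoc]
        refine (lintegral_const_mul_le _ _).trans (lintegral_mono fun x₄ => ?_)
        simp only [Fin.prod_univ_four, zeroSum, Matrix.cons_val_zero, Matrix.cons_val_succ, neg_neg,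
          g, Matrix.cons_val]
        rw [show x₄ + x₃ + x₂ + x₁ = x₁ + x₂ + x₃ + x₄ by abel]
        exact le_of_eq (by ring)

/-- The modulus of the weighted Fourier transform whose `L²` norm is the Bourgain norm. -/
def bourgainDensity (s b : ℝ) (φ : 𝓢(ℝ × ℝ, ℂ)) (x : ℝ × ℝ) : ℝ≥0∞ :=
  ENNReal.ofReal (jap s x.2 * jap b (modulation x)) * ‖planeFourier φ x‖ₑ

theorem measurable_bourgainDensity (s b : ℝ) (φ : 𝓢(ℝ × ℝ, ℂ)) :
    Measurable (bourgainDensity s b φ) := by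
  have h₁ := (planeFourier φ).continuous.enorm.measurable
  have h₂ := (continuous_jap s).measurable
  have h₃ := (continuous_jap b).measurable
  have h₄ := measurable_modulation
  unfold bourgainDensity
  fun_prop

theorem XNorm_sq (s b : ℝ) (φ : 𝓢(ℝ × ℝ, ℂ)) :
    XNorm 0 s b (fun t y => φ (t, y)) ^ 2 = ∫⁻ x, bourgainDensity s b φ x ^ 2 := by
  have h := eLpNorm_nnreal_pow_eq_lintegral (p := 2) (μ := volume) two_ne_zero
    (f := fun p : ℝ × ℝ => ((Real.exp (0 * |p.2|) * jap s p.2 * jap b (p.1 - p.2 ^ 3) : ℝ) : ℂ) *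
      FT2 (fun t y => φ (t, y)) p.1 p.2)
  simp only [NNReal.coe_ofNat, ENNReal.coe_ofNat, ENNReal.rpow_ofNat] at h
  rw [XNorm, h]
  refine lintegral_congr fun x => ?_
  rw [enorm_mul, FT2_eq_planeFourier, bourgainDensity, zero_mul, Real.exp_zero, one_mul,
    ← ofReal_norm, Complex.norm_real, Real.norm_of_nonneg]
  · rfl
  · exact (mul_pos (jap_pos _ _) (jap_pos _ _)).le

theorem bourgainDensity_lineDeriv (b : ℝ) (φ : 𝓢(ℝ × ℝ, ℂ)) (x : ℝ × ℝ) :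
    bourgainDensity 0 (-b) (∂_{((0 : ℝ), (1 : ℝ))} φ) x =
      ENNReal.ofReal |x.2| * modWeight b (modulation x) * ‖planeFourier φ x‖ₑ := by
  have h : jap 0 x.2 = 1 := by simp [jap]
  rw [bourgainDensity, planeFourier_lineDeriv, h, one_mul, ← modWeight]
  ring

theorem lintegral_bourgainDensity_sq_ne_top {b : ℝ} (hb : 0 ≤ b) (φ : 𝓢(ℝ × ℝ, ℂ)) :
    ∫⁻ x, bourgainDensity 0 (-b) φ x ^ 2 ≠ ⊤ := by
  have h := eLpNorm_nnreal_pow_eq_lintegral (p := 2) (μ := volume) two_ne_zero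
    (f := planeFourier φ)
  simp only [NNReal.coe_ofNat, ENNReal.coe_ofNat, ENNReal.rpow_ofNat] at h
  refine ne_top_of_le_ne_top (b := ∫⁻ x, ‖planeFourier φ x‖ₑ ^ 2) ?_ (lintegral_mono fun x => ?_)
  · rw [← h]
    exact ENNReal.pow_ne_top ((planeFourier φ).memLp 2 volume).eLpNorm_ne_top
  · have h₁ : jap 0 x.2 = 1 := by simp [jap]
    rw [bourgainDensity, h₁, one_mul, ← modWeight]
    exact pow_le_pow_left' (mul_le_of_le_one_left' (modWeight_le_one hb _)) 2

theorem enorm_planeFourier_eq (s b : ℝ) (φ : 𝓢(ℝ × ℝ, ℂ)) (x : ℝ × ℝ) :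
    ENNReal.ofReal (jap (-s) x.2) * (modWeight b (modulation x) * bourgainDensity s b φ x) =
      ‖planeFourier φ x‖ₑ := by
  rw [bourgainDensity, modWeight, ← mul_assoc, ← mul_assoc,
    ← ENNReal.ofReal_mul (jap_pos _ _).le,
    ← ENNReal.ofReal_mul (mul_pos (jap_pos _ _) (jap_pos _ _)).le, mul_mul_mul_comm,
    jap_neg_mul_jap, jap_neg_mul_jap]
  simp

theorem exists_lintegral_bourgainDensity_sq_le {b : ℝ} (hb : 1 / 2 < b) {s : Fin 4 → ℝ}
    (hs : ∀ j, s j ≤ 0) (hsum : ∑ j, s j = -(1 / 2)) : ∃ C : ℝ≥0∞, C ≠ ⊤ ∧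
    ∀ u : Fin 4 → 𝓢(ℝ × ℝ, ℂ),
      ∫⁻ x, bourgainDensity 0 (-b) (∂_{((0 : ℝ), (1 : ℝ))} (schwartzProd u)) x ^ 2 ≤
        C * ∏ j, ∫⁻ x, bourgainDensity (s j) b (u j) x ^ 2 := by
  have hb0 : 0 ≤ b := by linarith
  obtain ⟨c, hc, hprod⟩ := exists_lintegral_mul_enorm_planeFourier_schwartzProd_le
  obtain ⟨C, hC, hform⟩ := sq_zeroSumIntegral_multiplier_le (measurable_modWeight b)
    (modWeight_le_one hb0) (modWeight_neg b) (lintegral_modWeight_sq_ne_top hb)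
    (quadMultiplier_sq_le hs hsum)
  refine ⟨c ^ 2 * C, by finiteness, fun u => ?_⟩
  set h := bourgainDensity 0 (-b) (∂_{((0 : ℝ), (1 : ℝ))} (schwartzProd u))
  have hmeas : Measurable h := measurable_bourgainDensity _ _ _
  let w : ℝ × ℝ → ℝ≥0∞ := fun x => ENNReal.ofReal |x.2| * modWeight b (modulation x)
  have hw : Measurable w := by
    have h₁ := measurable_modWeight b
    have h₂ := measurable_modulation
    fun_prop
  have hhw : ∀ x, h x = w x * ‖planeFourier (schwartzProd u) x‖ₑ := fun x =>
    bourgainDensity_lineDeriv b _ x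
  let F : Fin 5 → ℝ × ℝ → ℝ≥0∞ :=
    Fin.cons (fun x => h (-x)) fun j => bourgainDensity (s j) b (u j)
  have hF : ∀ i, Measurable (F i) := by
    refine Fin.cases ?_ fun j => ?_
    · exact hmeas.comp measurable_neg
    · exact measurable_bourgainDensity _ _ _
  have hA : ∫⁻ x, h x ^ 2 ≠ ⊤ := lintegral_bourgainDensity_sq_ne_top hb0 _
  have h₁ : ∫⁻ x, h x ^ 2 ≤ c * zeroSumIntegral fun x =>
      quadMultiplier s x * ∏ i, (modWeight b (modulation (x i)) * F i (x i)) := by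
    calc ∫⁻ x, h x ^ 2 = ∫⁻ x, (h x * w x) * ‖planeFourier (schwartzProd u) x‖ₑ := by
          refine lintegral_congr fun x => ?_
          rw [mul_assoc, ← hhw, sq]
      _ ≤ _ := hprod u _ (hmeas.mul hw)
      _ ≤ _ := by
          refine mul_le_mul_right (zeroSumIntegral_mono fun x _ => le_of_eq ?_) _
          have hsplit : ∏ i, (modWeight b (modulation (x i)) * F i (x i)) =
              modWeight b (modulation (x 0)) * h (-(x 0)) *
                ∏ j : Fin 4, (modWeight b (modulation (x j.succ)) *
                  bourgainDensity (s j) b (u j) (x j.succ)) := Fin.prod_univ_succ _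
          rw [hsplit, quadMultiplier, ENNReal.ofReal_mul (abs_nonneg _),
            ENNReal.ofReal_prod_of_nonneg fun j _ => (jap_pos _ _).le]
          simp_rw [fun j => (enorm_planeFourier_eq (s j) b (u j) (x j.succ)).symm]
          simp only [w, Finset.prod_mul_distrib, modulation_neg, modWeight_neg, Prod.snd_neg,
            abs_neg]
          ring
  have h₂ : ∏ i, ∫⁻ x, F i x ^ 2 =
      (∫⁻ x, h x ^ 2) * ∏ j, ∫⁻ x, bourgainDensity (s j) b (u j) x ^ 2 := by
    rw [Fin.prod_univ_succ]
    simp only [F, Fin.cons_zero, Fin.cons_succ]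
    rw [lintegral_neg_eq_self (fun x => h x ^ 2)]
  have h₃ : (∫⁻ x, h x ^ 2) * (∫⁻ x, h x ^ 2) ≤ (∫⁻ x, h x ^ 2) *
      (c ^ 2 * C * ∏ j, ∫⁻ x, bourgainDensity (s j) b (u j) x ^ 2) := by
    calc (∫⁻ x, h x ^ 2) * (∫⁻ x, h x ^ 2) = (∫⁻ x, h x ^ 2) ^ 2 := (sq _).symm
      _ ≤ _ := pow_le_pow_left' h₁ 2
      _ ≤ c ^ 2 * (C * ∏ i, ∫⁻ x, F i x ^ 2) := by
          rw [mul_pow]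
          exact mul_le_mul_right (hform F hF) _
      _ = _ := by
          rw [h₂]
          ring
  by_cases h0 : ∫⁻ x, h x ^ 2 = 0
  · rw [h0]
    exact zero_le
  · exact (ENNReal.mul_le_mul_iff_right h0 hA).1 h₃

theorem deriv_eq_lineDeriv (φ : 𝓢(ℝ × ℝ, ℂ)) (t x : ℝ) :
    deriv (fun y => φ (t, y)) x = (∂_{((0 : ℝ), (1 : ℝ))} φ) (t, x) := by
  rw [SchwartzMap.lineDerivOp_apply_eq_fderiv]
  exact (φ.differentiableAt.hasFDerivAt.comp_hasDerivAt x
    ((hasDerivAt_const x t).prodMk (hasDerivAt_id x))).deriv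

end Assembly

/-- Quadrilinear estimate of Grünrock–Panthee–Silva: for `b > 1/2` and `s₁,…,s₄ ≤ 0` with
`s₁+s₂+s₃+s₄ = -1/2`, one has `‖∂_x(u₁u₂u₃u₄)‖_{X^{0,-b}} ≤ C ∏ ‖uⱼ‖_{X^{sⱼ,b}}`
for Schwartz `u₁,…,u₄`. -/
theorem quadrilinear_gps (b s₁ s₂ s₃ s₄ : ℝ) (hb : 1/2 < b)
    (h₁ : s₁ ≤ 0) (h₂ : s₂ ≤ 0) (h₃ : s₃ ≤ 0) (h₄ : s₄ ≤ 0)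
    (hsum : s₁ + s₂ + s₃ + s₄ = -(1/2)) :
    ∃ C > (0 : ℝ), ∀ u₁ u₂ u₃ u₄ : ℝ → ℝ → ℂ,
      IsSchwartz u₁ → IsSchwartz u₂ → IsSchwartz u₃ → IsSchwartz u₄ →
      XNorm 0 0 (-b) (fun t x => deriv (fun y => u₁ t y * u₂ t y * u₃ t y * u₄ t y) x) ≤
        ENNReal.ofReal C *
          (XNorm 0 s₁ b u₁ * XNorm 0 s₂ b u₂ * XNorm 0 s₃ b u₃ * XNorm 0 s₄ b u₄) := by
  obtain ⟨C, hC, h⟩ := exists_lintegral_bourgainDensity_sq_le hb (s := ![s₁, s₂, s₃, s₄])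
    (by intro j; fin_cases j <;> assumption) (by simpa [Fin.sum_univ_four] using hsum)
  refine ⟨C.toReal + 1, by positivity, ?_⟩
  rintro u₁ u₂ u₃ u₄ ⟨φ₁, e₁⟩ ⟨φ₂, e₂⟩ ⟨φ₃, e₃⟩ ⟨φ₄, e₄⟩
  obtain rfl : u₁ = fun t x => φ₁ (t, x) := funext₂ e₁
  obtain rfl : u₂ = fun t x => φ₂ (t, x) := funext₂ e₂
  obtain rfl : u₃ = fun t x => φ₃ (t, x) := funext₂ e₃
  obtain rfl : u₄ = fun t x => φ₄ (t, x) := funext₂ e₄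
  have hu := h ![φ₁, φ₂, φ₃, φ₄]
  have hCle : C ≤ ENNReal.ofReal (C.toReal + 1) ^ 2 := by
    have h₁ : ENNReal.ofReal (C.toReal + 1) = C + 1 := by
      rw [ENNReal.ofReal_add ENNReal.toReal_nonneg zero_le_one, ENNReal.ofReal_toReal hC,
        ENNReal.ofReal_one]
    rw [h₁]
    exact le_self_add.trans (le_self_pow le_add_self two_ne_zero)
  have hderiv : (fun t x : ℝ =>
      deriv (fun y => φ₁ (t, y) * φ₂ (t, y) * φ₃ (t, y) * φ₄ (t, y)) x) =
      fun t x => (LineDeriv.lineDerivOp ((0 : ℝ), (1 : ℝ))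
        (schwartzProd ![φ₁, φ₂, φ₃, φ₄])) (t, x) := by
    funext t x
    rw [← deriv_eq_lineDeriv]
    congr 1
    funext y
    simp [schwartzProd, schwartzMul_apply]
    ring
  rw [hderiv, ← ENNReal.pow_le_pow_left_iff two_ne_zero]
  simp only [mul_pow, XNorm_sq]
  refine hu.trans ?_
  rw [Fin.prod_univ_four]
  exact mul_le_mul_left hCle _
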